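/- Suppose the delayed mass-action system is a DeCBMAS and the network is a combination of ℓ subnetworks each of which is a 2d sub-DeCBMAS. Let W be a semilocking set of the combined network in Case II (every W^(p) is a nonempty vertex-type semilocking set of subnetwork p) with S_c ∩ W = ∅. Then: (i) W is a vertex-type semilocking set of the combined network, i.e. the only v ∈ 𝒮 with v_j = 0 for all j ∈ W is v = 0; and (ii) no ω-limit point of any bounded solution with positive initial condition lies on the boundary L_W. -/

import Mathlib

open Finset Filter

variable {n r : ℕ}

/-- Mass-action monomial `x^y = ∏ j, x j ^ y j`. -/
def mono (x : Fin n → ℝ) (y : Fin n → ℕ) : ℝ := ∏ j, x j ^ y j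

/-- A (bounded-domain) solution of the delayed mass-action system whose reactions are
those in the index set `R` (with reactant complexes `y`, product complexes `y'`,
rate constants `k`, delays `τ`, and maximal delay `τm`):
nonnegative, continuous on `[-τm, ∞)`, and satisfying the delay differential equation
`x'(t) = ∑ i ∈ R, k i (x(t-τ i)^{y i} • y' i - x(t)^{y i} • y i)` for `t > 0`. -/
def IsSolutionOn (y y' : Fin r → Fin n → ℕ) (k τ : Fin r → ℝ) (τm : ℝ)
    (R : Finset (Fin r)) (x : ℝ → Fin n → ℝ) : Prop :=
  (∀ t ∈ Set.Ici (-τm), ∀ j, 0 ≤ x t j) ∧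
  ContinuousOn x (Set.Ici (-τm)) ∧
  ∀ t > (0 : ℝ), HasDerivAt x
    (fun j => ∑ i ∈ R, k i * (mono (x (t - τ i)) (y i) * (y' i j : ℝ)
      - mono (x t) (y i) * (y i j : ℝ))) t

/-- A solution of the full delayed mass-action system. -/
def IsSolution (y y' : Fin r → Fin n → ℕ) (k τ : Fin r → ℝ) (τm : ℝ)
    (x : ℝ → Fin n → ℝ) : Prop :=
  IsSolutionOn y y' k τ τm Finset.univ x

/-- Positive initial condition: `x` is strictly positive on `[-τm, 0]`. -/
def PosInit (τm : ℝ) (x : ℝ → Fin n → ℝ) : Prop :=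
  ∀ t ∈ Set.Icc (-τm) 0, ∀ j, 0 < x t j

/-- The solution is bounded on `[-τm, ∞)`. -/
def BoundedSol (τm : ℝ) (x : ℝ → Fin n → ℝ) : Prop :=
  ∃ M : ℝ, ∀ t ∈ Set.Ici (-τm), ‖x t‖ ≤ M

/-- The (sub)system consisting of the reactions in `R` is complex balanced:
there is a positive state `xb` at which, for every complex `η`, the inflow and
outflow rates of `η` coincide. -/
def ComplexBalancedOn (y y' : Fin r → Fin n → ℕ) (k : Fin r → ℝ)
    (R : Finset (Fin r)) : Prop :=
  ∃ xb : Fin n → ℝ, (∀ j, 0 < xb j) ∧ ∀ η : Fin n → ℕ,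
    ∑ i ∈ R.filter (fun i => y i = η), k i * mono xb (y i)
      = ∑ i ∈ R.filter (fun i => y' i = η), k i * mono xb (y i)

/-- `W` is a semilocking set for the reactions in `R`. -/
def Semilocking (y y' : Fin r → Fin n → ℕ) (R : Finset (Fin r)) (W : Set (Fin n)) : Prop :=
  W.Nonempty ∧ ∀ i ∈ R, (∃ j ∈ W, y' i j ≠ 0) → ∃ j ∈ W, y i j ≠ 0

/-- Stoichiometric subspace spanned by the reaction vectors of the reactions in `R`. -/
def stoichOn (y y' : Fin r → Fin n → ℕ) (R : Finset (Fin r)) : Submodule ℝ (Fin n → ℝ) :=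
  Submodule.span ℝ {v | ∃ i ∈ R, v = fun j => (y' i j : ℝ) - (y i j : ℝ)}

/-- `W` is vertex-type w.r.t. the subspace `V`: the only `v ∈ V` vanishing on `W` is `0`. -/
def VertexType (V : Submodule ℝ (Fin n → ℝ)) (W : Set (Fin n)) : Prop :=
  ∀ v ∈ V, (∀ j ∈ W, v j = 0) → v = 0

/-- `W` is facet-type w.r.t. the subspace `V`: the projection of `V` onto the
coordinates outside `W` has dimension `dim V - 1`. -/
def FacetType (V : Submodule ℝ (Fin n → ℝ)) (W : Set (Fin n)) : Prop :=
  Module.finrank ℝ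
      (V.map (LinearMap.funLeft ℝ ℝ (Subtype.val : {j : Fin n // j ∉ W} → Fin n)))
    = Module.finrank ℝ V - 1

/-- The network is a combination of subnetworks with species sets `Sp p` and with
reaction `i` assigned to subnetwork `grp i`. -/
def IsCombination {l : ℕ} (y y' : Fin r → Fin n → ℕ) (Sp : Fin l → Set (Fin n))
    (grp : Fin r → Fin l) : Prop :=
  (∀ j, ∃ p, j ∈ Sp p) ∧ ∀ i j, (y i j ≠ 0 ∨ y' i j ≠ 0) → j ∈ Sp (grp i)

/-- The reaction index set of subnetwork `p`. -/
def Rgrp {l : ℕ} (grp : Fin r → Fin l) (p : Fin l) : Finset (Fin r) :=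
  Finset.univ.filter (fun i => grp i = p)

/-- The set `S_c` of intersecting species. -/
def interSpecies {l : ℕ} (Sp : Fin l → Set (Fin n)) : Set (Fin n) :=
  {j | ∃ p q, p ≠ q ∧ j ∈ Sp p ∧ j ∈ Sp q}

/-- `W^{cn}`: species outside `W` lying in some subnetwork `p'` with `W ∩ S^(p') = ∅`. -/
def Wcn {l : ℕ} (Sp : Fin l → Set (Fin n)) (W : Set (Fin n)) : Set (Fin n) :=
  {j | j ∉ W ∧ ∃ p, W ∩ Sp p = ∅ ∧ j ∈ Sp p}

/-- `W^{tf}`: completely unrestricted species outside `W`: they occur in some reaction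
all of whose species lie outside `W`. -/
def Wtf (y y' : Fin r → Fin n → ℕ) (W : Set (Fin n)) : Set (Fin n) :=
  {j | j ∉ W ∧ ∃ i, (y i j ≠ 0 ∨ y' i j ≠ 0) ∧
    ∀ j', (y i j' ≠ 0 ∨ y' i j' ≠ 0) → j' ∉ W}

/-- `W^{tr}`: totally restricted species outside `W`: every stoichiometric vector
vanishing on `W` also vanishes at `j`. -/
def Wtr (y y' : Fin r → Fin n → ℕ) (W : Set (Fin n)) : Set (Fin n) :=
  {j | j ∉ W ∧ ∀ v ∈ stoichOn y y' Finset.univ, (∀ j' ∈ W, v j' = 0) → v j = 0}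

/-- `θ` (a function on `[-τm,0]`) is an ω-limit point of the solution `x`. -/
def OmegaLimitPt (τm : ℝ) (x θ : ℝ → Fin n → ℝ) : Prop :=
  ContinuousOn θ (Set.Icc (-τm) 0) ∧ (∀ s ∈ Set.Icc (-τm) 0, ∀ j, 0 ≤ θ s j) ∧
  ∃ tN : ℕ → ℝ, Tendsto tN atTop atTop ∧
    ∀ ε > (0 : ℝ), ∃ N₀, ∀ N ≥ N₀, ∀ s ∈ Set.Icc (-τm) 0, ‖x (tN N + s) - θ s‖ < ε

/-- `θ` lies on the boundary `L_W`: it vanishes identically on the coordinates of `W`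
and is nowhere zero on the coordinates outside `W`. -/
def OnBoundary (τm : ℝ) (W : Set (Fin n)) (θ : ℝ → Fin n → ℝ) : Prop :=
  (∀ s ∈ Set.Icc (-τm) 0, ∀ j ∈ W, θ s j = 0) ∧
  ∀ s ∈ Set.Icc (-τm) 0, ∀ j ∉ W, θ s j ≠ 0

/-- Persistence of the delayed mass-action system: every bounded solution with
positive initial condition has `liminf_{t→∞} x_j(t) > 0` for every species `j`. -/
def Persistent (y y' : Fin r → Fin n → ℕ) (k τ : Fin r → ℝ) (τm : ℝ) : Prop :=
  ∀ x : ℝ → Fin n → ℝ, IsSolution y y' k τ τm x → PosInit τm x → BoundedSol τm x →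
    ∀ j, 0 < liminf (fun t => x t j) atTop




namespace Dl

lemma mono_pos' {x : Fin n → ℝ} (hx : ∀ j, 0 < x j) (η : Fin n → ℕ) : 0 < mono x η :=
  Finset.prod_pos fun j _ => pow_pos (hx j) _

lemma mono_nonneg' {x : Fin n → ℝ} (hx : ∀ j, 0 ≤ x j) (η : Fin n → ℕ) : 0 ≤ mono x η :=
  Finset.prod_nonneg fun j _ => pow_nonneg (hx j) _

lemma log_mono' {x : Fin n → ℝ} (hx : ∀ j, 0 < x j) (η : Fin n → ℕ) :
    Real.log (mono x η) = ∑ j, Real.log (x j) * (η j : ℝ) := by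
  unfold mono
  rw [Real.log_prod (fun j _ => (pow_pos (hx j) _).ne')]
  refine Finset.sum_congr rfl fun j _ => ?_
  rw [Real.log_pow]; ring

lemma mono_le_mono {x x2 : Fin n → ℝ} (hx : ∀ j, 0 ≤ x j) (h : ∀ j, x j ≤ x2 j)
    (η : Fin n → ℕ) : mono x η ≤ mono x2 η :=
  Finset.prod_le_prod (fun j _ => pow_nonneg (hx j) _) fun j _ => pow_le_pow_left₀ (hx j) (h j) _

lemma mono_eq_zero {x : Fin n → ℝ} {η : Fin n → ℕ} {j : Fin n} (hx : x j = 0) (h : η j ≠ 0) :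
    mono x η = 0 :=
  Finset.prod_eq_zero (Finset.mem_univ j) (by rw [hx, zero_pow h])

lemma mono_le_mul {x : Fin n → ℝ} {M : ℝ} (hM : 1 ≤ M) (hx : ∀ j, 0 ≤ x j) (h : ∀ j, x j ≤ M)
    {η : Fin n → ℕ} {j : Fin n} (hj : η j ≠ 0) : mono x η ≤ mono (fun _ => M) η * x j := by
  unfold mono
  rw [← Finset.mul_prod_erase _ _ (Finset.mem_univ j), ← Finset.mul_prod_erase _ _ (Finset.mem_univ j)]
  have h1 : ∏ i ∈ Finset.univ.erase j, x i ^ η i ≤ ∏ i ∈ Finset.univ.erase j, M ^ η i :=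
    Finset.prod_le_prod (fun j _ => pow_nonneg (hx j) _) fun j _ => pow_le_pow_left₀ (hx j) (h j) _
  have h2 : x j ^ η j ≤ M ^ η j * x j := by
    obtain ⟨p, hp⟩ := Nat.exists_eq_succ_of_ne_zero hj
    rw [hp, pow_succ]
    gcongr
    · exact hx j
    · calc x j ^ p ≤ M ^ p := pow_le_pow_left₀ (hx j) (h j) _
        _ ≤ M ^ (p+1) := pow_le_pow_right₀ hM (Nat.le_succ _)
  have h3 : 0 ≤ ∏ i ∈ Finset.univ.erase j, x i ^ η i :=
    Finset.prod_nonneg fun j _ => pow_nonneg (hx j) _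
  have h4 : 0 ≤ M ^ η j * x j := mul_nonneg (pow_nonneg (by linarith) _) (hx j)
  calc _ ≤ (M ^ η j * x j) * ∏ i ∈ Finset.univ.erase j, M ^ η i := mul_le_mul h2 h1 h3 h4
    _ = _ := by ring

lemma mono_cont (η : Fin n → ℕ) : Continuous (fun x : Fin n → ℝ => mono x η) := by
  unfold mono; fun_prop

lemma mono_lip (M : ℝ) (η : Fin n → ℕ) : ∃ C : ℝ, 0 ≤ C ∧ ∀ x x2 : Fin n → ℝ,
    (∀ j, 0 ≤ x j) → (∀ j, x j ≤ M) → (∀ j, 0 ≤ x2 j) → (∀ j, x2 j ≤ M) →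
    |mono x η - mono x2 η| ≤ C * ‖x - x2‖ := by
  have hc : ContDiff ℝ 1 (fun x : Fin n → ℝ => mono x η) := by
    unfold mono
    exact contDiff_prod fun i _ => (contDiff_apply ℝ ℝ i).pow _
  obtain ⟨K, hK⟩ := hc.contDiffOn.exists_lipschitzOnWith (s := Set.Icc (0 : Fin n → ℝ) (fun _ => M))
    one_ne_zero (convex_Icc _ _) isCompact_Icc
  refine ⟨K, K.2, fun x x2 a b c d => ?_⟩
  have := hK.dist_le_mul x ⟨a, b⟩ x2 ⟨c, d⟩
  rwa [dist_eq_norm, dist_eq_norm] at this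

lemma d_sqrt {a b : ℝ} (ha : 0 < a) (hb : 0 < b) :
    (√a - √b) ^ 2 ≤ a * (Real.log a - Real.log b) - a + b := by
  have sa := Real.sqrt_pos.2 ha
  have sb := Real.sqrt_pos.2 hb
  have ea := Real.sq_sqrt ha.le
  have eb := Real.sq_sqrt hb.le
  have h := Real.log_le_sub_one_of_pos (div_pos sb sa)
  rw [Real.log_div sb.ne' sa.ne', Real.log_sqrt ha.le, Real.log_sqrt hb.le] at h
  have h2 : a * (√b / √a) = √a * √b := by
    field_simp; rw [ea]
  have h3 := mul_le_mul_of_nonneg_left h ha.le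
  nlinarith

lemma d_nonneg {a b : ℝ} (ha : 0 < a) (hb : 0 < b) :
    0 ≤ a * (Real.log a - Real.log b) - a + b := (sq_nonneg _).trans (d_sqrt ha hb)

lemma d_q {a b : ℝ} (ha : 0 < a) (hb : 0 < b) (q : ℝ) :
    -(q ^ 2 * (a + b) / 2) ≤ a * (Real.log a - Real.log b) - a + b + q * (a - b) := by
  have h := d_sqrt ha hb
  have ea := Real.sq_sqrt ha.le
  have eb := Real.sq_sqrt hb.le
  set u := √a
  set v := √b
  have : (u - v) ^ 2 + q * (u ^ 2 - v ^ 2) + q ^ 2 * (u ^ 2 + v ^ 2) / 2 ≥ 0 := by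
    nlinarith [sq_nonneg ((u - v) + q * (u + v) / 2), sq_nonneg (q * (u - v))]
  rw [← ea, ← eb] at *
  nlinarith

lemma d_sq {a b : ℝ} (ha : 0 < a) (hb : 0 < b) :
    (a - b) ^ 2 ≤ 2 * (a + b) * (a * (Real.log a - Real.log b) - a + b) := by
  have h := d_sqrt ha hb
  have ea := Real.sq_sqrt ha.le
  have eb := Real.sq_sqrt hb.le
  refine le_trans ?_ (mul_le_mul_of_nonneg_left h (by positivity))
  set u := √a
  set v := √b
  rw [← ea, ← eb]
  nlinarith [sq_nonneg (u - v), mul_nonneg (sq_nonneg (u - v)) (sq_nonneg (u - v))]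

lemma phi_le {u z : ℝ} (hu : 0 < u) (hz : 0 < z) :
    u * (Real.log u - Real.log z) - u + z ≤ (u - z) ^ 2 / z := by
  have h := Real.log_le_sub_one_of_pos (div_pos hu hz)
  rw [Real.log_div hu.ne' hz.ne'] at h
  have h3 := mul_le_mul_of_nonneg_left h hu.le
  have : u * (u / z - 1) - u + z = (u - z) ^ 2 / z := by field_simp; ring
  linarith

lemma log_mul_ge {u z M : ℝ} (hu : 0 < u) (hz : 0 < z) (huM : u ≤ M) (hzM : z ≤ M) :
    (u - z) ^ 2 ≤ M * ((Real.log u - Real.log z) * (u - z)) := by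
  have key : ∀ a b : ℝ, 0 < a → 0 < b → a ≤ M → b ≤ a →
      (a - b) ^ 2 ≤ M * ((Real.log a - Real.log b) * (a - b)) := by
    intro a b ha hb haM hba
    have h := Real.log_le_sub_one_of_pos (div_pos hb ha)
    rw [Real.log_div hb.ne' ha.ne'] at h
    have h1 : a - b ≤ a * (Real.log a - Real.log b) := by
      have := mul_le_mul_of_nonneg_left h ha.le
      have e : a * (b / a - 1) = b - a := by field_simp
      nlinarith
    have h0 : 0 ≤ Real.log a - Real.log b := by
      have := Real.log_le_log hb hba; linarith
    have h2 : a - b ≤ M * (Real.log a - Real.log b) := h1.trans (by gcongr)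
    nlinarith
  rcases le_total z u with h | h
  · exact key u z hu hz huM h
  · have := key z u hz hu hzM h; nlinarith

lemma abs_log_le {u z : ℝ} (hz : 0 < z) (hu : z / 2 ≤ u) :
    |Real.log u - Real.log z| ≤ 2 / z * |u - z| := by
  have hu0 : 0 < u := by linarith
  have h1 := Real.log_le_sub_one_of_pos (div_pos hu0 hz)
  have h2 := Real.log_le_sub_one_of_pos (div_pos hz hu0)
  rw [Real.log_div hu0.ne' hz.ne'] at h1
  rw [Real.log_div hz.ne' hu0.ne'] at h2
  have e1 : u / z - 1 = 1 / z * (u - z) := by field_simp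
  have e2 : z / u - 1 = 1 / u * (z - u) := by field_simp
  have e3 : 1 / u ≤ 2 / z := by rw [div_le_div_iff₀ hu0 hz]; linarith
  have e4 : 1 / z ≤ 2 / z := by gcongr; norm_num
  have p1 : 0 < 1 / z := by positivity
  have p2 : 0 < 1 / u := by positivity
  rw [abs_le]
  constructor
  · have : 1 / u * (z - u) ≤ 2 / z * |u - z| := by
      calc _ ≤ 1 / u * |u - z| := by gcongr; rw [abs_sub_comm]; exact le_abs_self _
        _ ≤ _ := by gcongr
    linarith
  · have : 1 / z * (u - z) ≤ 2 / z * |u - z| := by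
      calc _ ≤ 1 / z * |u - z| := by gcongr; exact le_abs_self _
        _ ≤ _ := by gcongr
    linarith

lemma hasDerivAt_window {g : ℝ → ℝ} (hg : Continuous g) (a t : ℝ) :
    HasDerivAt (fun t => ∫ s in (t - a)..t, g s) (g t - g (t - a)) t := by
  have h0 : ∀ u, HasDerivAt (fun u => ∫ s in (0:ℝ)..u, g s) (g u) u := fun u =>
    intervalIntegral.integral_hasDerivAt_right (hg.intervalIntegrable _ _)
      hg.aestronglyMeasurable.stronglyMeasurableAtFilter hg.continuousAt
  have e : (fun t => ∫ s in (t - a)..t, g s) =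
      fun t => (∫ s in (0:ℝ)..t, g s) - ∫ s in (0:ℝ)..(t - a), g s := by
    funext t
    rw [intervalIntegral.integral_interval_sub_left (hg.intervalIntegrable _ _)
      (hg.intervalIntegrable _ _)]
  rw [e]
  have := (h0 (t - a)).comp t ((hasDerivAt_id t).sub_const a)
  simp only [mul_one] at this
  exact (h0 t).sub this

/-- comparison of increments -/
lemma incr_le {f g f' g' : ℝ → ℝ} {T a b : ℝ} (hf : ∀ t > T, HasDerivAt f (f' t) t)
    (hg : ∀ t > T, HasDerivAt g (g' t) t) (h : ∀ t > T, t ≤ b → f' t ≤ g' t) (ha : T < a) (hab : a ≤ b) :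
    f b - f a ≤ g b - g a := by
  have hm : MonotoneOn (fun t => g t - f t) (Set.Icc a b) := by
    refine monotoneOn_of_deriv_nonneg (convex_Icc a b) ?_ ?_ ?_
    · exact fun t ht => ((hg t (ha.trans_le ht.1)).sub (hf t (ha.trans_le ht.1))).continuousAt.continuousWithinAt
    · intro t ht
      rw [interior_Icc] at ht
      exact ((hg t (ha.trans ht.1)).sub (hf t (ha.trans ht.1))).differentiableAt.differentiableWithinAt
    · intro t ht
      rw [interior_Icc] at ht
      have hd : deriv (fun t => g t - f t) t = g' t - f' t :=
        ((hg t (ha.trans ht.1)).sub (hf t (ha.trans ht.1))).deriv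
      rw [hd]
      have := h t (ha.trans ht.1) ht.2.le
      linarith
  have := hm (Set.left_mem_Icc.2 hab) (Set.right_mem_Icc.2 hab) hab
  simp only at this
  linarith

end Dl


namespace Dl

structure Sys (n r : ℕ) where
  y : Fin r → Fin n → ℕ
  y' : Fin r → Fin n → ℕ
  k : Fin r → ℝ
  τ : Fin r → ℝ
  tm : ℝ
  hk : ∀ i, 0 < k i
  hτ : ∀ i, 0 ≤ τ i
  hτm : ∀ i, τ i ≤ tm
  htm : 0 ≤ tm
  xb : Fin n → ℝ
  hxb : ∀ j, 0 < xb j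
  hcb : ∀ F : (Fin n → ℕ) → ℝ, ∑ i, k i * mono xb (y i) * F (y i) = ∑ i, k i * mono xb (y i) * F (y' i)
  X : ℝ → Fin n → ℝ
  hcont : Continuous X
  hpos : ∀ t j, 0 < X t j
  M : ℝ
  hM1 : 1 ≤ M
  hM : ∀ t j, X t j ≤ M
  hder : ∀ t > 0, ∀ j, HasDerivAt (fun t => X t j)
    (∑ i, k i * (mono (X (t - τ i)) (y i) * (y' i j : ℝ) - mono (X t) (y i) * (y i j : ℝ))) t
  K : ℝ
  hK : 0 ≤ K
  hback : ∀ j s t, 0 ≤ s → s ≤ t → X s j ≤ Real.exp (K * (t - s)) * X t j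

namespace Sys

noncomputable section

variable (S : Sys n r)

/-- monomial along the trajectory -/
def m (i : Fin r) (t : ℝ) : ℝ := mono (S.X t) (S.y i)
def kap (i : Fin r) : ℝ := S.k i * mono S.xb (S.y i)
def e (t : ℝ) (η : Fin n → ℕ) : ℝ := mono (S.X t) η / mono S.xb η
def G (j : Fin n) (u : ℝ) : ℝ := u * Real.log u - u * Real.log (S.xb j) - u
def H (i : Fin r) (u : ℝ) : ℝ := u * Real.log u - u * Real.log (mono S.xb (S.y i)) - u
def vv (z : Fin n → ℝ) (t : ℝ) (j : Fin n) : ℝ :=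
  S.X t j - z j + ∑ i, S.k i * (S.y i j : ℝ) * ∫ s in (t - S.τ i)..t, (S.m i s - mono z (S.y i))
def f (J : Finset (Fin n)) (χ : (Fin n → ℕ) → ℝ) (lam z : Fin n → ℝ) (t : ℝ) : ℝ :=
  -(∑ j ∈ J, S.G j (S.X t j)) - ∑ j, lam j * S.vv z t j +
    ∑ i, S.k i * χ (S.y i) * ∫ s in (t - S.τ i)..t,
      ((∑ j, lam j * (S.y i j : ℝ)) * S.m i s - S.H i (S.m i s))
def V (t : ℝ) : ℝ := ∑ j, S.G j (S.X t j) + ∑ i, S.k i * ∫ s in (t - S.τ i)..t, S.H i (S.m i s)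
def dX (t : ℝ) (j : Fin n) : ℝ :=
  ∑ i, S.kap i * (S.e (t - S.τ i) (S.y i) * (S.y' i j : ℝ) - S.e t (S.y i) * (S.y i j : ℝ))

lemma m_cont (i) : Continuous (S.m i) := (mono_cont _).comp S.hcont
lemma H_cont (i) : Continuous (S.H i) := by
  unfold H
  have := Real.continuous_mul_log
  fun_prop
lemma G_cont (i) : Continuous (S.G i) := by
  unfold G
  have := Real.continuous_mul_log
  fun_prop
lemma m_pos (i t) : 0 < S.m i t := mono_pos' (S.hpos t) _
lemma xbm_pos (η) : 0 < mono S.xb η := mono_pos' S.hxb _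
lemma e_pos (t η) : 0 < S.e t η := div_pos (mono_pos' (S.hpos t) _) (S.xbm_pos _)
lemma kap_pos (i) : 0 < S.kap i := mul_pos (S.hk i) (S.xbm_pos _)
lemma kap_e (i t) : S.kap i * S.e t (S.y i) = S.k i * S.m i t := by
  have := (S.xbm_pos (S.y i)).ne'
  unfold kap e m; field_simp
lemma log_e (t η) : Real.log (S.e t η) = ∑ j, (Real.log (S.X t j) - Real.log (S.xb j)) * (η j : ℝ) := by
  unfold e
  rw [Real.log_div (mono_pos' (S.hpos t) _).ne' (S.xbm_pos _).ne', log_mono' (S.hpos t),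
    log_mono' S.hxb, ← Finset.sum_sub_distrib]
  exact Finset.sum_congr rfl fun j _ => by ring

lemma cb (F : (Fin n → ℕ) → ℝ) : ∑ i, S.kap i * F (S.y i) = ∑ i, S.kap i * F (S.y' i) := S.hcb F

lemma hX {t : ℝ} (ht : 0 < t) (j) : HasDerivAt (fun t => S.X t j) (S.dX t j) t := by
  convert S.hder t ht j using 1
  refine Finset.sum_congr rfl fun i _ => ?_
  have h1 := S.kap_e i t
  have h2 := S.kap_e i (t - S.τ i)
  simp only [m] at h1 h2
  linear_combination (S.y' i j : ℝ) * h2 - (S.y i j : ℝ) * h1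

lemma dX_eq (t j) : S.dX t j = ∑ i, S.kap i * (S.y' i j : ℝ) * (S.e (t - S.τ i) (S.y i) - S.e t (S.y' i)) := by
  have := S.cb (fun η => S.e t η * (η j : ℝ))
  unfold dX
  simp only [mul_sub, Finset.sum_sub_distrib]
  rw [this]
  congr 1 <;> exact Finset.sum_congr rfl fun i _ => by ring

lemma hG {t : ℝ} (ht : 0 < t) (j) : HasDerivAt (fun t => S.G j (S.X t j))
    ((Real.log (S.X t j) - Real.log (S.xb j)) * S.dX t j) t := by
  have h1 : HasDerivAt (S.G j) (Real.log (S.X t j) - Real.log (S.xb j)) (S.X t j) := by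
    have := ((Real.hasDerivAt_mul_log (S.hpos t j).ne').sub
      ((hasDerivAt_id (S.X t j)).mul_const (Real.log (S.xb j)))).sub (hasDerivAt_id (S.X t j))
    exact this.congr_deriv (by ring)
  exact h1.comp t (S.hX ht j)

lemma k_H (i t) : S.k i * S.H i (S.m i t) =
    S.kap i * (S.e t (S.y i) * Real.log (S.e t (S.y i)) - S.e t (S.y i)) := by
  have h : Real.log (S.e t (S.y i)) = Real.log (S.m i t) - Real.log (mono S.xb (S.y i)) :=
    Real.log_div (S.m_pos i t).ne' (S.xbm_pos _).ne'
  rw [h]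
  have := S.kap_e i t
  unfold H
  linear_combination (-(Real.log (S.m i t) - Real.log (mono S.xb (S.y i))) + 1) * this

lemma hvv (z) {t : ℝ} (ht : 0 < t) (j) : HasDerivAt (fun t => S.vv z t j)
    (S.dX t j + ∑ i, S.k i * (S.y i j : ℝ) * (S.m i t - S.m i (t - S.τ i))) t := by
  unfold vv
  refine ((S.hX ht j).sub_const _).add (HasDerivAt.fun_sum fun i _ => ?_)
  have := hasDerivAt_window (g := fun s => S.m i s - mono z (S.y i))
    ((S.m_cont i).sub continuous_const) (S.τ i) t
  exact (this.const_mul (S.k i * (S.y i j : ℝ))).congr_deriv (by ring)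

lemma hf (J : Finset (Fin n)) (χ : (Fin n → ℕ) → ℝ) (lam z : Fin n → ℝ)
    (hl : ∀ j ∈ J, lam j = 0) (hχ : ∀ i, χ (S.y i) = χ (S.y' i))
    (hχ2 : ∀ i, χ (S.y i) = 1 ∨ (χ (S.y i) = 0 ∧ S.y i = S.y' i ∧ ∀ j ∈ J, S.y i j = 0))
    {t : ℝ} (ht : 0 < t) : HasDerivAt (S.f J χ lam z)
    (∑ i, χ (S.y i) * S.kap i * (S.e (t - S.τ i) (S.y i) *
      (Real.log (S.e (t - S.τ i) (S.y i)) - Real.log (S.e t (S.y' i)))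
      - S.e (t - S.τ i) (S.y i) + S.e t (S.y' i)
      + (∑ j, (if j ∈ J then 0 else Real.log (S.X t j) - Real.log (S.xb j) - lam j) * (S.y' i j : ℝ))
        * (S.e (t - S.τ i) (S.y i) - S.e t (S.y' i)))) t := by
  have h1 := (HasDerivAt.fun_sum (u := J) fun j _ => S.hG ht j).fun_neg
  have h2 := HasDerivAt.fun_sum (u := Finset.univ) fun j _ => (S.hvv z ht j).const_mul (lam j)
  have h3 := HasDerivAt.fun_sum (u := Finset.univ) fun i (_ : i ∈ Finset.univ) =>
    (hasDerivAt_window (g := fun s => (∑ j, lam j * (S.y i j : ℝ)) * S.m i s - S.H i (S.m i s))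
      ((continuous_const.mul (S.m_cont i)).sub ((S.H_cont i).comp (S.m_cont i))) (S.τ i) t).const_mul
      (S.k i * χ (S.y i))
  have h4 := (h1.fun_sub h2).fun_add h3
  refine HasDerivAt.congr_deriv (f := S.f J χ lam z) h4 ?_
  clear h1 h2 h3 h4
  set mu : Fin n → ℝ := fun j => if j ∈ J then 0 else Real.log (S.X t j) - Real.log (S.xb j) - lam j with hmu
  set Lt : Fin n → ℝ := fun j => Real.log (S.X t j) - Real.log (S.xb j) - mu j with hLt
  have c1 : ∑ j ∈ J, (Real.log (S.X t j) - Real.log (S.xb j)) * S.dX t j + ∑ j, lam j * S.dX t j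
      = ∑ j, Lt j * S.dX t j := by
    have : ∑ j ∈ J, (Real.log (S.X t j) - Real.log (S.xb j)) * S.dX t j =
        ∑ j, if j ∈ J then (Real.log (S.X t j) - Real.log (S.xb j)) * S.dX t j else 0 := by
      rw [Finset.sum_ite_mem, Finset.univ_inter]
    rw [this, ← Finset.sum_add_distrib]
    refine Finset.sum_congr rfl fun j _ => ?_
    simp only [hLt, hmu]
    split_ifs with h
    · rw [hl j h]; ring
    · ring
  have c2 : ∑ j, Lt j * S.dX t j = ∑ i, S.kap i * (S.e (t - S.τ i) (S.y i) * (∑ j, Lt j * (S.y' i j : ℝ))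
      - S.e t (S.y i) * (∑ j, Lt j * (S.y i j : ℝ))) := by
    simp only [dX, Finset.mul_sum]
    rw [Finset.sum_comm]
    refine Finset.sum_congr rfl fun i _ => ?_
    rw [← Finset.sum_sub_distrib, Finset.mul_sum]
    exact Finset.sum_congr rfl fun j _ => by ring
  have c3 : ∑ j, lam j * (S.dX t j + ∑ i, S.k i * (S.y i j : ℝ) * (S.m i t - S.m i (t - S.τ i)))
      = ∑ j, lam j * S.dX t j + ∑ i, (∑ j, lam j * (S.y i j : ℝ)) *
        (S.k i * S.m i t - S.k i * S.m i (t - S.τ i)) := by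
    simp only [mul_add, Finset.sum_add_distrib]
    congr 1
    simp only [Finset.mul_sum, Finset.sum_mul]
    rw [Finset.sum_comm]
    refine Finset.sum_congr rfl fun i _ => ?_
    exact Finset.sum_congr rfl fun j _ => by ring
  have cLt : ∀ η : Fin n → ℕ, ∑ j, Lt j * (η j : ℝ) = Real.log (S.e t η) - ∑ j, mu j * (η j : ℝ) := by
    intro η
    rw [S.log_e, ← Finset.sum_sub_distrib]
    exact Finset.sum_congr rfl fun j _ => by simp only [hLt]; ring
  have c4 := S.cb (fun η => χ η * (S.e t η * (1 - ∑ j, mu j * (η j : ℝ))))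
  have c5 : ∀ i, S.kap i * (χ (S.y i) * (S.e t (S.y i) * (1 - ∑ j, mu j * (S.y i j : ℝ)))) +
      χ (S.y i) * S.kap i * (S.e (t - S.τ i) (S.y i) *
      (Real.log (S.e (t - S.τ i) (S.y i)) - Real.log (S.e t (S.y' i)))
      - S.e (t - S.τ i) (S.y i) + (∑ j, mu j * (S.y' i j : ℝ)) * S.e (t - S.τ i) (S.y i)) =
      - (S.kap i * (S.e (t - S.τ i) (S.y i) * (∑ j, Lt j * (S.y' i j : ℝ))
      - S.e t (S.y i) * (∑ j, Lt j * (S.y i j : ℝ)))) - (∑ j, lam j * (S.y i j : ℝ)) *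
        (S.k i * S.m i t - S.k i * S.m i (t - S.τ i)) +
      S.k i * χ (S.y i) *
        ((∑ j, lam j * (S.y i j : ℝ)) * S.m i t - S.H i (S.m i t) -
          ((∑ j, lam j * (S.y i j : ℝ)) * S.m i (t - S.τ i) - S.H i (S.m i (t - S.τ i)))) := by
    intro i
    have k1 := S.kap_e i t
    have k2 := S.kap_e i (t - S.τ i)
    have k3 := S.k_H i t
    have k4 := S.k_H i (t - S.τ i)
    rcases hχ2 i with h | ⟨h, hy, hJ⟩
    · rw [h, cLt, cLt]
      linear_combination k3 - k4
    · rw [h, ← hy]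
      have : ∑ j, Lt j * (S.y i j : ℝ) = ∑ j, lam j * (S.y i j : ℝ) := by
        refine Finset.sum_congr rfl fun j _ => ?_
        simp only [hLt, hmu]
        split_ifs with h'
        · rw [hJ j h']; simp
        · ring
      rw [this]
      linear_combination (∑ j, lam j * (S.y i j : ℝ)) * (k2 - k1)
  rw [c3]
  have c6 := Finset.sum_congr rfl fun i (_ : i ∈ Finset.univ) => c5 i
  rw [Finset.sum_add_distrib, Finset.sum_add_distrib, Finset.sum_sub_distrib, Finset.sum_neg_distrib] at c6
  rw [← c2, ← c1, c4, ← Finset.sum_add_distrib] at c6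
  symm
  calc _ = _ := Finset.sum_congr rfl fun i _ => ?_
    _ = _ := c6
    _ = _ := by ring
  rw [← hχ i]; ring

lemma V_eq (t) : S.V t = - S.f Finset.univ (fun _ => 1) 0 0 t := by
  simp [V, f]
  ring

def D (t : ℝ) : ℝ := ∑ i, S.kap i * (S.e (t - S.τ i) (S.y i) *
      (Real.log (S.e (t - S.τ i) (S.y i)) - Real.log (S.e t (S.y' i)))
      - S.e (t - S.τ i) (S.y i) + S.e t (S.y' i))

lemma hV {t : ℝ} (ht : 0 < t) : HasDerivAt S.V (- S.D t) t := by
  have h := (S.hf Finset.univ (fun _ => 1) 0 0 (by simp) (by simp) (by simp) ht).neg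
  have e : S.V = - S.f Finset.univ (fun _ => 1) 0 0 := by funext t; exact S.V_eq t
  rw [e]
  refine h.congr_deriv ?_
  simp [D]

lemma D_nonneg (t) : 0 ≤ S.D t :=
  Finset.sum_nonneg fun i _ => mul_nonneg (S.kap_pos i).le (d_nonneg (S.e_pos _ _) (S.e_pos _ _))

lemma V_anti {s t : ℝ} (hs : 0 < s) (hst : s ≤ t) : S.V t ≤ S.V s := by
  have := incr_le (T := 0) (f := S.V) (g := fun _ => 0) (g' := fun _ => 0) (fun t ht => S.hV ht)
    (fun t _ => hasDerivAt_const t 0) (fun t _ _ => neg_nonpos.2 (S.D_nonneg t)) hs hst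
  linarith

def mM (η : Fin n → ℕ) : ℝ := mono (fun _ => S.M) η
lemma M_pos : 0 < S.M := by linarith [S.hM1]
lemma mM_pos (η) : 0 < S.mM η := mono_pos' (fun _ => S.M_pos) _
lemma mono_le (t η) : mono (S.X t) η ≤ S.mM η := mono_le_mono (fun j => (S.hpos t j).le) (S.hM t) η
lemma e_le (t η) : S.e t η ≤ S.mM η / mono S.xb η :=
  div_le_div_of_nonneg_right (S.mono_le t η) (S.xbm_pos η).le

lemma dX_le (j : Fin n) : ∃ C : ℝ, 0 ≤ C ∧ ∀ t, ∀ h > 0, |S.dX t j| ≤ C * h + C * S.D t / h := by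
  set B : Fin r → ℝ := fun i => S.mM (S.y i) / mono S.xb (S.y i) + S.mM (S.y' i) / mono S.xb (S.y' i) with hB
  have hB0 : ∀ i, 0 < B i := fun i =>
    add_pos (div_pos (S.mM_pos _) (S.xbm_pos _)) (div_pos (S.mM_pos _) (S.xbm_pos _))
  set C1 : ℝ := ∑ i, S.kap i * (S.y' i j : ℝ)
  set C2 : ℝ := ∑ i, (S.y' i j : ℝ) * B i
  have hC1 : 0 ≤ C1 := Finset.sum_nonneg fun i _ => mul_nonneg (S.kap_pos i).le (Nat.cast_nonneg _)
  have hC2 : 0 ≤ C2 := Finset.sum_nonneg fun i _ => mul_nonneg (Nat.cast_nonneg _) (hB0 i).le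
  refine ⟨C1 + C2, by positivity, fun t h hh => ?_⟩
  rw [S.dX_eq]
  have key : ∀ i, |S.kap i * (S.y' i j : ℝ) * (S.e (t - S.τ i) (S.y i) - S.e t (S.y' i))| ≤
      S.kap i * (S.y' i j : ℝ) * h + C2 / h * (S.kap i * (S.e (t - S.τ i) (S.y i) *
      (Real.log (S.e (t - S.τ i) (S.y i)) - Real.log (S.e t (S.y' i)))
      - S.e (t - S.τ i) (S.y i) + S.e t (S.y' i))) := by
    intro i
    have ha := S.e_pos (t - S.τ i) (S.y i)
    have hb := S.e_pos t (S.y' i)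
    have ha' := S.e_le (t - S.τ i) (S.y i)
    have hb' := S.e_le t (S.y' i)
    have d1 := d_sq ha hb
    have d0 := d_nonneg ha hb
    set a := S.e (t - S.τ i) (S.y i)
    set b := S.e t (S.y' i)
    set d := a * (Real.log a - Real.log b) - a + b
    have hk := S.kap_pos i
    have hy : (0:ℝ) ≤ (S.y' i j : ℝ) := Nat.cast_nonneg _
    have h1 : |a - b| ≤ h + B i * d / h := by
      rw [← sub_le_iff_le_add', le_div_iff₀ hh]
      have : (a - b) ^ 2 ≤ 2 * B i * d := d1.trans (by
        apply mul_le_mul_of_nonneg_right _ d0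
        simp only [hB]; linarith)
      rw [← sq_abs] at this
      nlinarith [sq_nonneg (|a - b| - h), sq_nonneg (|a-b| - 2 * h), abs_nonneg (a-b), mul_nonneg (hB0 i).le d0]
    have h2 : (S.y' i j : ℝ) * B i ≤ C2 :=
      Finset.single_le_sum (f := fun i => (S.y' i j : ℝ) * B i)
        (fun i _ => mul_nonneg (Nat.cast_nonneg _) (hB0 i).le) (Finset.mem_univ i)
    rw [abs_mul, abs_of_nonneg (mul_nonneg hk.le hy)]
    calc _ ≤ S.kap i * (S.y' i j : ℝ) * (h + B i * d / h) := by gcongr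
      _ = S.kap i * (S.y' i j : ℝ) * h + ((S.y' i j : ℝ) * B i) / h * (S.kap i * d) := by ring
      _ ≤ _ := by gcongr
  calc _ ≤ _ := Finset.abs_sum_le_sum_abs _ _
    _ ≤ _ := Finset.sum_le_sum fun i _ => key i
    _ = C1 * h + C2 * S.D t / h := by
      rw [Finset.sum_add_distrib, ← Finset.mul_sum, ← Finset.sum_mul, D]; ring
    _ ≤ _ := by
      have := S.D_nonneg t
      gcongr <;> linarith

lemma osc : ∃ C : ℝ, 0 ≤ C ∧ ∀ t > S.tm, ∀ s ∈ Set.Icc (t - S.tm) t,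
    ‖S.X s - S.X t‖ ≤ C * √(S.V (t - S.tm) - S.V t) := by
  choose C hC0 hC using S.dX_le
  set A := ∑ j, C j
  have hA : ∀ j, C j ≤ A := fun j => Finset.single_le_sum (fun j _ => hC0 j) (Finset.mem_univ j)
  have hA0 : 0 ≤ A := Finset.sum_nonneg fun j _ => hC0 j
  have htm := S.htm
  refine ⟨A * S.tm + A, by positivity, fun t ht s hs => ?_⟩
  rw [pi_norm_le_iff_of_nonneg (by positivity)]
  intro j
  have hs0 : 0 < s := by linarith [hs.1]
  set Δ := S.V (t - S.tm) - S.V t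
  have hd0 : 0 ≤ Δ := sub_nonneg.2 (S.V_anti (by linarith) (by linarith))
  have hds : S.V s - S.V t ≤ Δ := sub_le_sub_right (S.V_anti (by linarith) hs.1) _
  have main : ∀ h > 0, |S.X s j - S.X t j| ≤ A * S.tm * h + A * Δ / h := by
    intro h hh
    have hg : ∀ u > 0, HasDerivAt (fun u => C j * h * u - C j / h * S.V u) (C j * h + C j * S.D u / h) u := by
      intro u hu
      exact (((hasDerivAt_id u).const_mul (C j * h)).sub ((S.hV hu).const_mul (C j / h))).congr_deriv (by ring)
    have i1 := incr_le (fun u hu => S.hX hu j) hg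
      (fun u hu _ => (abs_le.1 (hC j u h hh)).2) hs0 hs.2
    have i2 := incr_le (fun u hu => (S.hX hu j).fun_neg) hg
      (fun u hu _ => by linarith [(abs_le.1 (hC j u h hh)).1]) hs0 hs.2
    have b1 : C j * h * t - C j / h * S.V t - (C j * h * s - C j / h * S.V s) ≤ A * S.tm * h + A * Δ / h := by
      calc _ = C j * (t - s) * h + C j * (S.V s - S.V t) / h := by ring
        _ ≤ A * S.tm * h + A * Δ / h := by
          have := hC0 j
          have : 0 ≤ t - s := by linarith [hs.2]
          have : 0 ≤ S.V s - S.V t := sub_nonneg.2 (S.V_anti hs0 hs.2)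
          gcongr
          · exact hA j
          · linarith [hs.1]
          · exact hA j
    rw [abs_le]; constructor <;> linarith
  rw [Pi.sub_apply, Real.norm_eq_abs]
  rcases hd0.eq_or_lt with h0 | h0
  · rw [← h0] at main ⊢
    simp only [Real.sqrt_zero, mul_zero, zero_div, add_zero] at main ⊢
    refine le_of_forall_pos_le_add fun ε hε => ?_
    have := main (ε / (A * S.tm + 1)) (by positivity)
    have h2 : A * S.tm * (ε / (A * S.tm + 1)) ≤ ε := by
      rw [← mul_div_assoc, div_le_iff₀ (by positivity)]; nlinarith
    linarith
  · have hsq := Real.sqrt_pos.2 h0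
    have := main (√Δ) hsq
    have e : A * Δ / √Δ = A * √Δ := by rw [mul_div_assoc, Real.div_sqrt]
    rw [e] at this
    linarith

end

end Sys
end Dl


namespace Dl

structure Loc (n r : ℕ) extends Sys n r where
  W : Finset (Fin n)
  z : Fin n → ℝ
  hzW : ∀ j ∈ W, z j = 0
  hz : ∀ j ∉ W, 0 < z j
  hzM : ∀ j, z j ≤ M
  hW : W.Nonempty
  htc : ∀ i, (∃ j ∈ W, y i j ≠ 0) ↔ (∃ j ∈ W, y' i j ≠ 0)
  hU : ∀ i, (∀ j ∈ W, y i j = 0) → y i = y' i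
  c : Fin n → Fin n → ℝ
  hc : ∀ i j, (y' i j : ℝ) - (y i j : ℝ) = ∑ j' ∈ W, c j j' * ((y' i j' : ℝ) - (y i j' : ℝ))
  tN : ℕ → ℝ
  htN : Tendsto tN atTop atTop
  hlim : ∀ ε > 0, ∃ N0, ∀ N ≥ N0, ∀ s ∈ Set.Icc (tN N - tm) (tN N), ‖X s - z‖ < ε

lemma Sys.win_int (S : Sys n r) {g : ℝ → ℝ} {t C : ℝ} (i : Fin r)
    (h : ∀ s ∈ Set.Icc (t - S.tm) t, |g s| ≤ C) : |∫ s in (t - S.τ i)..t, g s| ≤ C * S.τ i := by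
  have := intervalIntegral.norm_integral_le_of_norm_le_const (f := g) (C := C) (a := t - S.τ i) (b := t) (by
    intro s hs
    rw [Set.uIoc_of_le (by linarith [S.hτ i])] at hs
    exact h s ⟨by linarith [hs.1, S.hτm i], hs.2⟩)
  rwa [sub_sub_cancel, abs_of_nonneg (S.hτ i)] at this

lemma Sys.win_int' (S : Sys n r) {g : ℝ → ℝ} {t C : ℝ} (i : Fin r) (hC : 0 ≤ C)
    (h : ∀ s ∈ Set.Icc (t - S.tm) t, |g s| ≤ C) : |∫ s in (t - S.τ i)..t, g s| ≤ C * S.tm :=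
  (S.win_int i h).trans (mul_le_mul_of_nonneg_left (S.hτm i) hC)

namespace Loc

noncomputable section

open Classical in
def chi (S : Loc n r) (η : Fin n → ℕ) : ℝ := if ∃ j ∈ S.W, η j ≠ 0 then 1 else 0

variable (S : Loc n r)

def lam (j : Fin n) : ℝ := if j ∈ S.W then 0 else Real.log (S.z j) - Real.log (S.xb j)
def w (t : ℝ) : ℝ := ∑ j ∈ S.W, S.X t j

lemma z_nonneg (j) : 0 ≤ S.z j := by
  by_cases h : j ∈ S.W
  · rw [S.hzW j h]
  · exact (S.hz j h).le

lemma w_pos (t) : 0 < S.w t := Finset.sum_pos (fun j _ => S.hpos t j) S.hW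
lemma X_le_w {j} (h : j ∈ S.W) (t) : S.X t j ≤ S.w t :=
  Finset.single_le_sum (f := fun j => S.X t j) (fun j _ => (S.hpos t j).le) h

lemma lipm : ∃ C : ℝ, 0 ≤ C ∧ ∀ i, ∀ x x2 : Fin n → ℝ,
    (∀ j, 0 ≤ x j) → (∀ j, x j ≤ S.M) → (∀ j, 0 ≤ x2 j) → (∀ j, x2 j ≤ S.M) →
    |mono x (S.y i) - mono x2 (S.y i)| ≤ C * ‖x - x2‖ := by
  choose C h0 h using fun i => mono_lip S.M (S.y i)
  refine ⟨∑ i, C i, Finset.sum_nonneg fun i _ => h0 i, fun i x x2 a b c d => (h i x x2 a b c d).trans ?_⟩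
  gcongr
  exact Finset.single_le_sum (fun i _ => h0 i) (Finset.mem_univ i)

lemma lip_z : ∃ C : ℝ, 0 ≤ C ∧ ∀ i s, |S.m i s - mono S.z (S.y i)| ≤ C * ‖S.X s - S.z‖ := by
  obtain ⟨C, h0, h⟩ := S.lipm
  exact ⟨C, h0, fun i s => h i _ _ (fun j => (S.hpos s j).le) (S.hM s) S.z_nonneg S.hzM⟩

lemma lip_X : ∃ C : ℝ, 0 ≤ C ∧ ∀ i s t, |S.m i s - S.m i t| ≤ C * ‖S.X s - S.X t‖ := by
  obtain ⟨C, h0, h⟩ := S.lipm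
  exact ⟨C, h0, fun i s t => h i _ _ (fun j => (S.hpos s j).le) (S.hM s) (fun j => (S.hpos t j).le) (S.hM t)⟩

lemma vv_small : ∃ C : ℝ, 0 ≤ C ∧ ∀ j t ε, (∀ s ∈ Set.Icc (t - S.tm) t, ‖S.X s - S.z‖ ≤ ε) →
    |S.vv S.z t j| ≤ C * ε := by
  obtain ⟨L, hL0, hL⟩ := S.lip_z
  have htm := S.htm
  set B : Fin n → ℝ := fun j => ∑ i, S.k i * (S.y i j : ℝ) * (L * S.tm) with hB
  have hk : ∀ i j, 0 ≤ S.k i * (S.y i j : ℝ) := fun i j => mul_nonneg (S.hk i).le (Nat.cast_nonneg _)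
  have hB0 : ∀ j, 0 ≤ B j := fun j => Finset.sum_nonneg fun i _ => mul_nonneg (hk i j) (by positivity)
  refine ⟨1 + ∑ j, B j, add_nonneg zero_le_one (Finset.sum_nonneg fun j _ => hB0 j), fun j t ε h => ?_⟩
  have ht := h t ⟨by linarith, le_rfl⟩
  have hε : 0 ≤ ε := (norm_nonneg _).trans ht
  have h1 : |S.X t j - S.z j| ≤ ε := (norm_le_pi_norm (S.X t - S.z) j).trans ht
  have h2 : |∑ i, S.k i * (S.y i j : ℝ) * ∫ s in (t - S.τ i)..t, (S.m i s - mono S.z (S.y i))| ≤ B j * ε := by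
    refine (Finset.abs_sum_le_sum_abs _ _).trans ?_
    rw [hB, Finset.sum_mul]
    refine Finset.sum_le_sum fun i _ => ?_
    rw [abs_mul, abs_of_nonneg (hk i j), mul_assoc (S.k i * (S.y i j : ℝ)) (L * S.tm)]
    refine mul_le_mul_of_nonneg_left ?_ (hk i j)
    have := S.win_int' (g := fun s => S.m i s - mono S.z (S.y i)) (C := L * ε) i (by positivity)
      (fun s hs => (hL i s).trans (by have := h s hs; gcongr))
    calc _ ≤ _ := this
      _ = _ := by ring
  have h3 : B j ≤ ∑ j, B j := Finset.single_le_sum (fun j _ => hB0 j) (Finset.mem_univ j)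
  calc _ ≤ _ := abs_add_le _ _
    _ ≤ ε + B j * ε := add_le_add h1 h2
    _ ≤ ε + (∑ j, B j) * ε := by gcongr
    _ = _ := by ring

lemma vlin {t : ℝ} (ht : 0 < t) (j) : S.vv S.z t j = ∑ j' ∈ S.W, S.c j j' * S.vv S.z t j' := by
  have hd : ∀ t > 0, HasDerivAt (fun t => S.vv S.z t j - ∑ j' ∈ S.W, S.c j j' * S.vv S.z t j') 0 t := by
    intro t ht
    have h1 : ∀ j, HasDerivAt (fun t => S.vv S.z t j)
        (∑ i, S.k i * S.m i (t - S.τ i) * ((S.y' i j : ℝ) - (S.y i j : ℝ))) t := by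
      intro j
      refine (S.hvv S.z ht j).congr_deriv ?_
      unfold Sys.dX
      rw [← Finset.sum_add_distrib]
      refine Finset.sum_congr rfl fun i _ => ?_
      have k1 := S.kap_e i t
      have k2 := S.kap_e i (t - S.τ i)
      linear_combination (S.y' i j : ℝ) * k2 - (S.y i j : ℝ) * k1
    have h2 := (h1 j).fun_sub (HasDerivAt.fun_sum (u := S.W) fun j' _ => (h1 j').const_mul (S.c j j'))
    refine h2.congr_deriv ?_
    rw [sub_eq_zero]
    simp only [Finset.mul_sum]
    rw [Finset.sum_comm]
    refine Finset.sum_congr rfl fun i _ => ?_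
    rw [S.hc i j, Finset.mul_sum]
    exact Finset.sum_congr rfl fun j' _ => by ring
  have hconst : ∀ s, t ≤ s → S.vv S.z s j - ∑ j' ∈ S.W, S.c j j' * S.vv S.z s j' =
      S.vv S.z t j - ∑ j' ∈ S.W, S.c j j' * S.vv S.z t j' := by
    intro s hs
    have i1 := incr_le hd (fun t _ => hasDerivAt_const t (0:ℝ)) (fun _ _ _ => le_rfl) ht hs
    have i2 := incr_le (fun t _ => hasDerivAt_const t (0:ℝ)) hd (fun _ _ _ => le_rfl) ht hs
    linarith
  obtain ⟨C, hC0, hC⟩ := S.vv_small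
  set A := 1 + ∑ j' ∈ S.W, |S.c j j'| with hA
  have hA0 : 0 < A := by positivity
  rw [← sub_eq_zero, ← abs_eq_zero]
  refine le_antisymm (le_of_forall_pos_le_add fun ε hε => ?_) (abs_nonneg _)
  obtain ⟨N0, hN0⟩ := S.hlim (ε / (A * (C + 1))) (by positivity)
  obtain ⟨N, hN1, hN2⟩ := ((eventually_ge_atTop N0).and (S.htN.eventually_ge_atTop t)).exists
  rw [← hconst _ hN2]
  have hv := fun j => hC j (S.tN N) _ (fun s hs => (hN0 N hN1 s hs).le)
  set q := C * (ε / (A * (C + 1)))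
  calc _ ≤ |S.vv S.z (S.tN N) j| + |∑ j' ∈ S.W, S.c j j' * S.vv S.z (S.tN N) j'| := abs_sub _ _
    _ ≤ q + ∑ j' ∈ S.W, |S.c j j'| * q := by
      refine add_le_add (hv j) ((Finset.abs_sum_le_sum_abs _ _).trans (Finset.sum_le_sum fun j' _ => ?_))
      rw [abs_mul]
      exact mul_le_mul_of_nonneg_left (hv j') (abs_nonneg _)
    _ = A * q := by rw [← Finset.sum_mul, hA]; ring
    _ = C / (C + 1) * ε := by simp only [q]; field_simp
    _ ≤ 0 + ε := by
      rw [zero_add]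
      have : C / (C + 1) ≤ 1 := by rw [div_le_one (by positivity)]; linarith
      nlinarith

lemma touch_le {η : Fin n → ℕ} (hη : ∃ j ∈ S.W, η j ≠ 0) {t : ℝ} (ht : S.tm < t) {s : ℝ}
    (hs : s ∈ Set.Icc (t - S.tm) t) :
    mono (S.X s) η ≤ S.mM η * Real.exp (S.K * S.tm) * S.w t := by
  obtain ⟨j, hj, hηj⟩ := hη
  have h1 := mono_le_mul S.hM1 (fun j => (S.hpos s j).le) (S.hM s) hηj
  have h2 := S.hback j s t (by linarith [hs.1]) hs.2
  have h3 : S.X s j ≤ Real.exp (S.K * S.tm) * S.w t := by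
    refine h2.trans (mul_le_mul ?_ (S.X_le_w hj t) (S.hpos t j).le (Real.exp_pos _).le)
    refine Real.exp_le_exp.2 (mul_le_mul_of_nonneg_left (by linarith [hs.1]) S.hK)
  calc _ ≤ _ := h1
    _ ≤ S.mM η * (Real.exp (S.K * S.tm) * S.w t) := mul_le_mul_of_nonneg_left h3 (S.mM_pos η).le
    _ = _ := by ring

lemma z_touch {η : Fin n → ℕ} (hη : ∃ j ∈ S.W, η j ≠ 0) : mono S.z η = 0 := by
  obtain ⟨j, hj, h⟩ := hη
  exact mono_eq_zero (S.hzW j hj) h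

/-- common constant for touching monomials -/
lemma touch_m : ∃ C : ℝ, 0 ≤ C ∧ ∀ i, (∃ j ∈ S.W, S.y i j ≠ 0) → ∀ t > S.tm,
    ∀ s ∈ Set.Icc (t - S.tm) t, S.m i s ≤ C * S.w t := by
  have h0 : ∀ i, 0 ≤ S.mM (S.y i) * Real.exp (S.K * S.tm) := fun i =>
    mul_nonneg (S.mM_pos _).le (Real.exp_pos _).le
  refine ⟨∑ i, S.mM (S.y i) * Real.exp (S.K * S.tm), Finset.sum_nonneg fun i _ => h0 i,
    fun i hi t ht s hs => (S.touch_le hi ht hs).trans ?_⟩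
  have := S.w_pos t
  gcongr
  exact Finset.single_le_sum (f := fun i => S.mM (S.y i) * Real.exp (S.K * S.tm))
    (fun i _ => h0 i) (Finset.mem_univ i)

lemma vvW : ∃ A : ℝ, 0 ≤ A ∧ ∀ t > S.tm, ∀ j, |S.vv S.z t j| ≤ A * S.w t := by
  obtain ⟨C, hC0, hC⟩ := S.touch_m
  have htm := S.htm
  have hk : ∀ i j, 0 ≤ S.k i * (S.y i j : ℝ) := fun i j => mul_nonneg (S.hk i).le (Nat.cast_nonneg _)
  set B : Fin n → ℝ := fun j => 1 + ∑ i, S.k i * (S.y i j : ℝ) * (C * S.tm) with hB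
  have hB0 : ∀ j, 0 ≤ B j := fun j => add_nonneg zero_le_one
    (Finset.sum_nonneg fun i _ => mul_nonneg (hk i j) (by positivity))
  have h1 : ∀ t > S.tm, ∀ j ∈ S.W, |S.vv S.z t j| ≤ B j * S.w t := by
    intro t ht j hj
    have hw := S.w_pos t
    have a1 : |S.X t j - S.z j| ≤ S.w t := by
      rw [S.hzW j hj, sub_zero, abs_of_pos (S.hpos t j)]; exact S.X_le_w hj t
    have a2 : |∑ i, S.k i * (S.y i j : ℝ) * ∫ s in (t - S.τ i)..t, (S.m i s - mono S.z (S.y i))| ≤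
        (∑ i, S.k i * (S.y i j : ℝ) * (C * S.tm)) * S.w t := by
      refine (Finset.abs_sum_le_sum_abs _ _).trans ?_
      rw [Finset.sum_mul]
      refine Finset.sum_le_sum fun i _ => ?_
      by_cases hy : S.y i j = 0
      · simp [hy]
      have hti : ∃ j ∈ S.W, S.y i j ≠ 0 := ⟨j, hj, hy⟩
      rw [abs_mul, abs_of_nonneg (hk i j), mul_assoc (S.k i * (S.y i j : ℝ)) (C * S.tm)]
      refine mul_le_mul_of_nonneg_left ?_ (hk i j)
      have := S.win_int' (g := fun s => S.m i s - mono S.z (S.y i)) (C := C * S.w t) i (by positivity)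
        (fun s hs => by
          rw [S.z_touch hti, sub_zero, abs_of_pos (S.m_pos i s)]; exact hC i hti t ht s hs)
      calc _ ≤ _ := this
        _ = _ := by ring
    calc _ ≤ _ := abs_add_le _ _
      _ ≤ _ := add_le_add a1 a2
      _ = _ := by rw [hB]; ring
  have hq : ∀ j, 0 ≤ ∑ j' ∈ S.W, |S.c j j'| * B j' := fun j =>
    Finset.sum_nonneg fun j' _ => mul_nonneg (abs_nonneg _) (hB0 _)
  refine ⟨∑ j, ∑ j' ∈ S.W, |S.c j j'| * B j', Finset.sum_nonneg fun j _ => hq j, fun t ht j => ?_⟩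
  rw [S.vlin (by linarith) j]
  have hw := S.w_pos t
  calc _ ≤ _ := Finset.abs_sum_le_sum_abs _ _
    _ ≤ ∑ j' ∈ S.W, |S.c j j'| * B j' * S.w t := by
      refine Finset.sum_le_sum fun j' hj' => ?_
      rw [abs_mul, mul_assoc]
      exact mul_le_mul_of_nonneg_left (h1 t ht j' hj') (abs_nonneg _)
    _ = (∑ j' ∈ S.W, |S.c j j'| * B j') * S.w t := by rw [Finset.sum_mul]
    _ ≤ _ := by
      gcongr
      exact Finset.single_le_sum (f := fun j => ∑ j' ∈ S.W, |S.c j j'| * B j')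
        (fun j _ => hq j) (Finset.mem_univ j)

abbrev ff (t : ℝ) : ℝ := S.f S.W S.chi S.lam S.z t

lemma chi_one {η : Fin n → ℕ} (h : ∃ j ∈ S.W, η j ≠ 0) : S.chi η = 1 := if_pos h
lemma chi_zero {η : Fin n → ℕ} (h : ¬ ∃ j ∈ S.W, η j ≠ 0) : S.chi η = 0 := if_neg h
lemma chi_nonneg (η) : 0 ≤ S.chi η := by unfold chi; split_ifs <;> norm_num

/-- lower bound for `ff` near `z` -/
lemma ff_ge : ∀ᶠ ρ in nhdsWithin (0:ℝ) (Set.Ioi 0), ∀ t > S.tm,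
    (∀ s ∈ Set.Icc (t - S.tm) t, ‖S.X s - S.z‖ ≤ ρ) → S.w t ≤ S.ff t := by
  obtain ⟨A, hA0, hA⟩ := S.vvW
  set A' := ∑ j, |S.lam j| * A with hA'
  have e1 : ∀ᶠ ρ in nhdsWithin (0:ℝ) (Set.Ioi 0), ∀ j, Real.log ρ ≤ Real.log (S.xb j) - A' :=
    eventually_all.2 fun j => Real.tendsto_log_nhdsGT_zero.eventually_le_atBot _
  have e2 : ∀ᶠ ρ in nhdsWithin (0:ℝ) (Set.Ioi 0), ∀ i, Real.log ρ ≤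
      (∑ j, S.lam j * (S.y i j : ℝ)) + Real.log (mono S.xb (S.y i)) + 1 - Real.log (S.mM (S.y i)) :=
    eventually_all.2 fun j => Real.tendsto_log_nhdsGT_zero.eventually_le_atBot _
  filter_upwards [e1, e2, self_mem_nhdsWithin] with ρ h1 h2 hρ t ht hnear
  have hρ : 0 < ρ := hρ
  have htm := S.htm
  have nearW : ∀ s ∈ Set.Icc (t - S.tm) t, ∀ j ∈ S.W, S.X s j ≤ ρ := by
    intro s hs j hj
    have := (norm_le_pi_norm (S.X s - S.z) j).trans (hnear s hs)
    rw [Pi.sub_apply, S.hzW j hj, sub_zero] at this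
    exact (le_abs_self _).trans this
  have t1 : (A' + 1) * S.w t ≤ -(∑ j ∈ S.W, S.G j (S.X t j)) := by
    rw [w, Finset.mul_sum, ← Finset.sum_neg_distrib]
    refine Finset.sum_le_sum fun j hj => ?_
    have hx := S.hpos t j
    have hl : Real.log (S.X t j) ≤ Real.log ρ := Real.log_le_log hx (nearW t ⟨by linarith, le_rfl⟩ j hj)
    have := h1 j
    unfold Sys.G
    nlinarith
  have t2 : |∑ j, S.lam j * S.vv S.z t j| ≤ A' * S.w t := by
    refine (Finset.abs_sum_le_sum_abs _ _).trans ?_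
    rw [hA', Finset.sum_mul]
    refine Finset.sum_le_sum fun j _ => ?_
    rw [abs_mul, mul_assoc]
    exact mul_le_mul_of_nonneg_left (hA t ht j) (abs_nonneg _)
  have t3 : 0 ≤ ∑ i, S.k i * S.chi (S.y i) * ∫ s in (t - S.τ i)..t,
      ((∑ j, S.lam j * (S.y i j : ℝ)) * S.m i s - S.H i (S.m i s)) := by
    refine Finset.sum_nonneg fun i _ => ?_
    by_cases hi : ∃ j ∈ S.W, S.y i j ≠ 0
    · refine mul_nonneg (mul_nonneg (S.hk i).le (S.chi_nonneg _)) ?_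
      refine intervalIntegral.integral_nonneg (by linarith [S.hτ i]) fun s hs => ?_
      have hs' : s ∈ Set.Icc (t - S.tm) t := ⟨by linarith [hs.1, S.hτm i], hs.2⟩
      obtain ⟨j, hj, hij⟩ := hi
      have hm := S.m_pos i s
      have hle : S.m i s ≤ S.mM (S.y i) * ρ :=
        (mono_le_mul S.hM1 (fun j => (S.hpos s j).le) (S.hM s) hij).trans
          (mul_le_mul_of_nonneg_left (nearW s hs' j hj) (S.mM_pos _).le)
      have hl := Real.log_le_log hm hle
      rw [Real.log_mul (S.mM_pos _).ne' hρ.ne'] at hl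
      have := h2 i
      unfold Sys.H
      nlinarith
    · rw [S.chi_zero hi]; simp
  have := (abs_le.1 t2).2
  unfold ff Sys.f
  linarith

end

end Loc
end Dl

namespace Dl

lemma quad {b l : Fin n → ℝ} {P M Z : ℝ} (hM : 0 ≤ M) (hP : 0 ≤ P) (hZ : 0 ≤ Z)
    (h1 : ∀ j, b j ^ 2 ≤ M * (l j * b j)) (h2 : ∀ j, |l j| ≤ Z * |b j|)
    (h3 : ∑ j, l j * b j ≤ P * ∑ j, |l j|) : ∑ j, |b j| ≤ n * M * Z * P := by
  set σ := ∑ j, |b j| with hσ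
  have hσ0 : 0 ≤ σ := Finset.sum_nonneg fun j _ => abs_nonneg _
  have c1 : σ ^ 2 ≤ n * ∑ j, |b j| ^ 2 := by
    have := sq_sum_le_card_mul_sum_sq (s := (Finset.univ : Finset (Fin n))) (f := fun j => |b j|)
    simpa using this
  have c2 : ∑ j, |b j| ^ 2 ≤ M * (P * (Z * σ)) := by
    calc _ ≤ ∑ j, M * (l j * b j) := Finset.sum_le_sum fun j _ => by rw [sq_abs]; exact h1 j
      _ = M * ∑ j, l j * b j := by rw [Finset.mul_sum]
      _ ≤ M * (P * ∑ j, |l j|) := by gcongr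
      _ ≤ M * (P * (Z * σ)) := by
        have : ∑ j, |l j| ≤ Z * σ := by
          rw [hσ, Finset.mul_sum]
          exact Finset.sum_le_sum fun j _ => h2 j
        gcongr
  rcases hσ0.eq_or_lt with h | h
  · rw [← h]; positivity
  have c3 : σ * σ ≤ (n * M * Z * P) * σ := by
    calc σ * σ = σ ^ 2 := by ring
      _ ≤ n * (M * (P * (Z * σ))) := c1.trans (by gcongr)
      _ = _ := by ring
  exact le_of_mul_le_mul_right c3 h

lemma log_mul_nonneg {u v : ℝ} (hu : 0 < u) (hv : 0 < v) :
    0 ≤ (Real.log u - Real.log v) * (u - v) := by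
  rcases le_total u v with h | h
  · have := Real.log_le_log hu h
    nlinarith
  · have := Real.log_le_log hv h
    nlinarith

namespace Loc

noncomputable section

variable (S : Loc n r)

lemma z_mono_pos {η : Fin n → ℕ} (h : ¬ ∃ j ∈ S.W, η j ≠ 0) : 0 < mono S.z η := by
  push Not at h
  refine Finset.prod_pos fun j _ => ?_
  by_cases hj : j ∈ S.W
  · rw [h j hj, pow_zero]; exact one_pos
  · exact pow_pos (S.hz j hj) _

lemma z_log {η : Fin n → ℕ} (h : ¬ ∃ j ∈ S.W, η j ≠ 0) :
    Real.log (mono S.z η) = ∑ j, Real.log (S.z j) * (η j : ℝ) := by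
  push Not at h
  unfold mono
  rw [Real.log_prod]
  · exact Finset.sum_congr rfl fun j _ => by rw [Real.log_pow]; ring
  · intro j _
    by_cases hj : j ∈ S.W
    · rw [h j hj, pow_zero]; exact one_ne_zero
    · exact (pow_pos (S.hz j hj) _).ne'

/-- ρ is smaller than half of each outer coordinate -/
def Small (ρ : ℝ) : Prop := ∀ j ∉ S.W, ρ ≤ S.z j / 2

lemma ev_small : ∀ᶠ ρ in nhdsWithin (0:ℝ) (Set.Ioi 0), S.Small ρ := by
  refine eventually_all.2 fun j => ?_
  by_cases hj : j ∈ S.W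
  · simp [hj]
  · have := S.hz j hj
    have : ∀ᶠ ρ in nhdsWithin (0:ℝ) (Set.Ioi 0), ρ < S.z j / 2 :=
      nhdsWithin_le_nhds (Iio_mem_nhds (by linarith))
    filter_upwards [this] with ρ h _ using h.le

def Zi : ℝ := ∑ j, 2 / S.z j

lemma Zi_nonneg : 0 ≤ S.Zi := Finset.sum_nonneg fun j _ => div_nonneg zero_le_two (S.z_nonneg j)

lemma log_le {ρ t : ℝ} (hρ : S.Small ρ) (h : ‖S.X t - S.z‖ ≤ ρ) {j} (hj : j ∉ S.W) :
    |Real.log (S.X t j) - Real.log (S.z j)| ≤ S.Zi * |S.X t j - S.z j| := by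
  have h1 : |S.X t j - S.z j| ≤ ρ := (norm_le_pi_norm (S.X t - S.z) j).trans h
  have h2 := (abs_le.1 h1).1
  have h3 := hρ j hj
  refine (abs_log_le (S.hz j hj) (by linarith)).trans (mul_le_mul_of_nonneg_right ?_ (abs_nonneg _))
  exact Finset.single_le_sum (f := fun j => 2 / S.z j)
    (fun j _ => div_nonneg zero_le_two (S.z_nonneg j)) (Finset.mem_univ j)

lemma near : ∃ C : ℝ, 0 ≤ C ∧ ∀ ρ, S.Small ρ → ∀ t > S.tm,
    ‖S.X t - S.z‖ ≤ ρ → ∀ δ,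
    (∀ s ∈ Set.Icc (t - S.tm) t, ‖S.X s - S.X t‖ ≤ δ) →
    ∀ s ∈ Set.Icc (t - S.tm) t, ‖S.X s - S.z‖ ≤ C * (δ + S.w t) := by
  obtain ⟨A, hA0, hA⟩ := S.vvW
  obtain ⟨L, hL0, hL⟩ := S.lip_X
  obtain ⟨C, hC0, hC⟩ := S.touch_m
  have htm := S.htm
  have hM := S.M_pos.le
  have hk : ∀ i j, 0 ≤ S.k i * (S.y i j : ℝ) := fun i j => mul_nonneg (S.hk i).le (Nat.cast_nonneg _)
  set Y : ℝ := ∑ i, ∑ j, S.k i * (S.y i j : ℝ) with hY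
  have hY0 : 0 ≤ Y := Finset.sum_nonneg fun i _ => Finset.sum_nonneg fun j _ => hk i j
  have hYj : ∀ j, ∑ i, S.k i * (S.y i j : ℝ) ≤ Y := by
    intro j
    rw [hY, Finset.sum_comm]
    exact Finset.single_le_sum (f := fun j => ∑ i, S.k i * (S.y i j : ℝ))
      (fun j _ => Finset.sum_nonneg fun i _ => hk i j) (Finset.mem_univ j)
  set B := A + Y * (L * S.tm) + Y * (C * S.tm) with hB
  have hB0 : 0 ≤ B := by positivity
  have hZ := S.Zi_nonneg
  refine ⟨n * S.M * S.Zi * B + 1, by positivity, fun ρ hρ t ht hnear δ hδ => ?_⟩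
  have hw := S.w_pos t
  have hδ0 : 0 ≤ δ := (norm_nonneg _).trans (hδ t ⟨by linarith, le_rfl⟩)
  set l : Fin n → ℝ := fun j => if j ∈ S.W then 0 else Real.log (S.X t j) - Real.log (S.z j) with hl
  set b : Fin n → ℝ := fun j => if j ∈ S.W then 0 else S.X t j - S.z j with hb
  set R : Fin n → ℝ := fun j => S.X t j - S.z j +
    ∑ i, S.k i * (S.y i j : ℝ) * (S.τ i * (S.m i t - mono S.z (S.y i))) with hR
  have r1 : ∀ j, |R j| ≤ (A + Y * (L * S.tm)) * (δ + S.w t) := by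
    intro j
    have e1 : R j = S.vv S.z t j - ∑ i, S.k i * (S.y i j : ℝ) * ∫ s in (t - S.τ i)..t, (S.m i s - S.m i t) := by
      rw [hR]
      unfold Sys.vv
      rw [add_sub_assoc, ← Finset.sum_sub_distrib]
      refine congrArg₂ (· + ·) rfl (Finset.sum_congr rfl fun i _ => ?_)
      have hi := (S.m_cont i).intervalIntegrable (μ := MeasureTheory.volume) (t - S.τ i) t
      rw [intervalIntegral.integral_sub hi (by simp), intervalIntegral.integral_sub hi (by simp)]
      simp only [intervalIntegral.integral_const, smul_eq_mul]
      ring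
    have e2 : |∑ i, S.k i * (S.y i j : ℝ) * ∫ s in (t - S.τ i)..t, (S.m i s - S.m i t)| ≤ Y * (L * δ * S.tm) := by
      refine (Finset.abs_sum_le_sum_abs _ _).trans ?_
      calc _ ≤ ∑ i, S.k i * (S.y i j : ℝ) * (L * δ * S.tm) := by
            refine Finset.sum_le_sum fun i _ => ?_
            rw [abs_mul, abs_of_nonneg (hk i j)]
            refine mul_le_mul_of_nonneg_left ?_ (hk i j)
            exact S.win_int' i (by positivity) fun s hs => (hL i s t).trans (by have := hδ s hs; gcongr)
        _ = (∑ i, S.k i * (S.y i j : ℝ)) * (L * δ * S.tm) := by rw [Finset.sum_mul]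
        _ ≤ _ := by have := hYj j; gcongr
    rw [e1]
    calc _ ≤ _ := abs_sub _ _
      _ ≤ A * S.w t + Y * (L * δ * S.tm) := add_le_add (hA t ht j) e2
      _ ≤ A * (δ + S.w t) + Y * (L * (δ + S.w t) * S.tm) := by gcongr <;> linarith
      _ = _ := by ring
  have r2 : ∑ j, l j * b j ≤ (B * (δ + S.w t)) * ∑ j, |l j| := by
    have e1 : ∑ j, l j * R j = ∑ j, l j * b j +
        ∑ i, S.k i * S.τ i * ((∑ j, l j * (S.y i j : ℝ)) * (S.m i t - mono S.z (S.y i))) := by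
      have : ∀ j, l j * b j = l j * (S.X t j - S.z j) := by
        intro j; simp only [hl, hb]; split_ifs <;> ring
      simp only [this, hR, mul_add, Finset.sum_add_distrib, Finset.mul_sum, Finset.sum_mul]
      rw [Finset.sum_comm (f := fun j i => l j * (S.k i * (S.y i j : ℝ) * (S.τ i * (S.m i t - mono S.z (S.y i)))))]
      congr 1
      exact Finset.sum_congr rfl fun i _ => Finset.sum_congr rfl fun j _ => by ring
    have e2 : ∀ i, -(∑ j, S.k i * (S.y i j : ℝ) * (C * S.tm * (δ + S.w t)) * |l j|) ≤
        S.k i * S.τ i * ((∑ j, l j * (S.y i j : ℝ)) * (S.m i t - mono S.z (S.y i))) := by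
      intro i
      have hki := S.hk i
      have hti := S.hτ i
      by_cases hi : ∃ j ∈ S.W, S.y i j ≠ 0
      · rw [S.z_touch hi, sub_zero]
        have q1 := hC i hi t ht t ⟨by linarith, le_rfl⟩
        have q0 := (S.m_pos i t).le
        have q3 := S.hτm i
        refine neg_le_of_abs_le ?_
        rw [abs_mul (S.k i * S.τ i), abs_mul _ (S.m i t), abs_of_nonneg (mul_nonneg hki.le hti), abs_of_nonneg q0]
        calc _ ≤ S.k i * S.tm * ((∑ j, |l j| * (S.y i j : ℝ)) * (C * (δ + S.w t))) := by
              gcongr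
              · refine (Finset.abs_sum_le_sum_abs _ _).trans (le_of_eq ?_)
                exact Finset.sum_congr rfl fun j _ => by rw [abs_mul, abs_of_nonneg (Nat.cast_nonneg (α := ℝ) _)]
              · refine q1.trans ?_
                gcongr; linarith
          _ = _ := by
              simp only [Finset.mul_sum, Finset.sum_mul]
              exact Finset.sum_congr rfl fun j _ => by ring
      · have q : ∑ j, l j * (S.y i j : ℝ) = Real.log (S.m i t) - Real.log (mono S.z (S.y i)) := by
          unfold Sys.m
          rw [log_mono' (S.hpos t), S.z_log hi, ← Finset.sum_sub_distrib]
          refine Finset.sum_congr rfl fun j _ => ?_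
          simp only [hl]
          split_ifs with h
          · push Not at hi; rw [hi j h]; simp
          · ring
        rw [q]
        have p1 := log_mul_nonneg (S.m_pos i t) (S.z_mono_pos hi)
        have p2 : 0 ≤ ∑ j, S.k i * (S.y i j : ℝ) * (C * S.tm * (δ + S.w t)) * |l j| := by positivity
        have p3 : 0 ≤ S.k i * S.τ i := by positivity
        nlinarith [mul_nonneg p3 p1]
    have e3 : ∑ j, l j * R j ≤ ((A + Y * (L * S.tm)) * (δ + S.w t)) * ∑ j, |l j| := by
      rw [Finset.mul_sum]
      refine Finset.sum_le_sum fun j _ => ?_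
      calc _ ≤ |l j * R j| := le_abs_self _
        _ = |R j| * |l j| := by rw [abs_mul, mul_comm]
        _ ≤ _ := mul_le_mul_of_nonneg_right (r1 j) (abs_nonneg _)
    have e4 := Finset.sum_le_sum fun i (_ : i ∈ Finset.univ) => e2 i
    have e5 : ∑ i, ∑ j, S.k i * (S.y i j : ℝ) * (C * S.tm * (δ + S.w t)) * |l j| ≤
        (Y * (C * S.tm) * (δ + S.w t)) * ∑ j, |l j| := by
      rw [Finset.sum_comm, Finset.mul_sum]
      refine Finset.sum_le_sum fun j _ => ?_
      rw [← Finset.sum_mul, ← Finset.sum_mul]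
      refine mul_le_mul_of_nonneg_right ?_ (abs_nonneg _)
      rw [mul_assoc Y]
      have := hYj j
      gcongr
    rw [Finset.sum_neg_distrib] at e4
    rw [hB]
    linarith
  have r3 := quad hM (by positivity) hZ (l := l) (b := b) (fun j => by
    simp only [hl, hb]
    split_ifs with h
    · simp
    · exact log_mul_ge (S.hpos t j) (S.hz j h) (S.hM t j) (S.hzM j)) (fun j => by
    simp only [hl, hb]
    split_ifs with h
    · simp
    · exact S.log_le hρ hnear h) r2
  have hs0 : 0 ≤ ∑ j, |b j| := Finset.sum_nonneg fun j _ => abs_nonneg _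
  have r4 : ‖S.X t - S.z‖ ≤ ∑ j, |b j| + S.w t := by
    refine (pi_norm_le_iff_of_nonneg (by positivity)).2 fun j => ?_
    rw [Pi.sub_apply, Real.norm_eq_abs]
    by_cases h : j ∈ S.W
    · rw [S.hzW j h, sub_zero, abs_of_pos (S.hpos t j)]
      linarith [S.X_le_w h t]
    · have h1 : |b j| ≤ ∑ j, |b j| := Finset.single_le_sum (f := fun j => |b j|) (fun j _ => abs_nonneg _) (Finset.mem_univ j)
      have h2 : b j = S.X t j - S.z j := by simp only [hb]; rw [if_neg h]
      rw [h2] at h1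
      linarith
  intro s hs
  have r5 : ‖S.X s - S.z‖ ≤ ‖S.X s - S.X t‖ + ‖S.X t - S.z‖ := norm_sub_le_norm_sub_add_norm_sub _ _ _
  have := hδ s hs
  linarith

end
end Loc
end Dl

namespace Dl
namespace Loc

noncomputable section

variable (S : Loc n r)

def Vz : ℝ := ∑ j, S.G j (S.z j) + ∑ i, S.k i * (S.τ i * S.H i (mono S.z (S.y i)))

lemma qbound : ∃ C : ℝ, 0 ≤ C ∧ ∀ t ε, (∀ s ∈ Set.Icc (t - S.tm) t, ‖S.X s - S.z‖ ≤ ε) →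
    S.ff t + S.V t - S.Vz ≤ C * ε ^ 2 := by
  obtain ⟨L, hL0, hL⟩ := S.lip_z
  have htm := S.htm
  have hmz : ∀ i, 0 ≤ mono S.z (S.y i) := fun i => mono_nonneg' S.z_nonneg _
  have c0 : ∀ i, 0 ≤ S.k i * (L ^ 2 / mono S.z (S.y i) * S.tm) := fun i => by
    have := S.hk i; have := hmz i; positivity
  refine ⟨∑ j, 1 / S.z j + ∑ i, S.k i * (L ^ 2 / mono S.z (S.y i) * S.tm),
    add_nonneg (Finset.sum_nonneg fun j _ => div_nonneg zero_le_one (S.z_nonneg j))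
      (Finset.sum_nonneg fun i _ => c0 i), fun t ε h => ?_⟩
  have ht := h t ⟨by linarith, le_rfl⟩
  have hε : 0 ≤ ε := (norm_nonneg _).trans ht
  have j1 : ∀ j, (if j ∈ S.W then 0 else S.G j (S.X t j)) - S.G j (S.z j) - S.lam j * (S.X t j - S.z j)
      ≤ 1 / S.z j * ε ^ 2 := by
    intro j
    unfold lam
    split_ifs with hj
    · rw [S.hzW j hj]; simp [Sys.G]
    · have hz := S.hz j hj
      have h1 := phi_le (S.hpos t j) hz
      have h2 : |S.X t j - S.z j| ≤ ε := (norm_le_pi_norm (S.X t - S.z) j).trans ht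
      have h3 : (S.X t j - S.z j) ^ 2 ≤ ε ^ 2 := by rw [← sq_abs]; gcongr
      have h4 : (S.X t j - S.z j) ^ 2 / S.z j ≤ ε ^ 2 / S.z j := by gcongr
      unfold Sys.G
      rw [one_div_mul_eq_div]
      linarith
  have i1 : ∀ i, S.k i * S.chi (S.y i) * (∫ s in (t - S.τ i)..t,
        ((∑ j, S.lam j * (S.y i j : ℝ)) * S.m i s - S.H i (S.m i s)))
      + S.k i * (∫ s in (t - S.τ i)..t, S.H i (S.m i s)) - S.k i * (S.τ i * S.H i (mono S.z (S.y i)))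
      - S.k i * ((∑ j, S.lam j * (S.y i j : ℝ)) * ∫ s in (t - S.τ i)..t, (S.m i s - mono S.z (S.y i)))
      ≤ S.k i * (L ^ 2 / mono S.z (S.y i) * S.tm) * ε ^ 2 := by
    intro i
    have hm := (S.m_cont i).intervalIntegrable (μ := MeasureTheory.volume) (t - S.τ i) t
    have hH := ((S.H_cont i).comp (S.m_cont i)).intervalIntegrable (μ := MeasureTheory.volume) (t - S.τ i) t
    simp only [Function.comp_def] at hH
    set Λ := ∑ j, S.lam j * (S.y i j : ℝ) with hΛ
    have k1 : ∫ s in (t - S.τ i)..t, (Λ * S.m i s - S.H i (S.m i s)) =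
        Λ * (∫ s in (t - S.τ i)..t, S.m i s) - ∫ s in (t - S.τ i)..t, S.H i (S.m i s) := by
      rw [intervalIntegral.integral_sub (hm.const_mul _) hH, intervalIntegral.integral_const_mul]
    have k2 : ∫ s in (t - S.τ i)..t, (S.m i s - mono S.z (S.y i)) =
        (∫ s in (t - S.τ i)..t, S.m i s) - S.τ i * mono S.z (S.y i) := by
      rw [intervalIntegral.integral_sub hm (by simp)]; simp
    by_cases hi : ∃ j ∈ S.W, S.y i j ≠ 0
    · rw [S.chi_one hi, k1, k2, S.z_touch hi]
      simp only [Sys.H]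
      simp
      apply le_of_eq
      ring
    · rw [S.chi_zero hi]
      have hz := S.z_mono_pos hi
      have hΛ2 : Λ = Real.log (mono S.z (S.y i)) - Real.log (mono S.xb (S.y i)) := by
        rw [S.z_log hi, log_mono' S.hxb, ← Finset.sum_sub_distrib, hΛ]
        refine Finset.sum_congr rfl fun j _ => ?_
        unfold lam
        split_ifs with h
        · push Not at hi; rw [hi j h]; simp
        · ring
      have k3 : ∫ s in (t - S.τ i)..t, (S.H i (S.m i s) - Λ * S.m i s
          + (Λ * mono S.z (S.y i) - S.H i (mono S.z (S.y i)))) =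
          (∫ s in (t - S.τ i)..t, S.H i (S.m i s)) - Λ * (∫ s in (t - S.τ i)..t, S.m i s)
          + S.τ i * (Λ * mono S.z (S.y i) - S.H i (mono S.z (S.y i))) := by
        rw [intervalIntegral.integral_add (hH.sub (hm.const_mul _)) (by simp),
          intervalIntegral.integral_sub hH (hm.const_mul _), intervalIntegral.integral_const_mul]
        simp
        ring
      have k4 := S.win_int' (g := fun s => S.H i (S.m i s) - Λ * S.m i s
          + (Λ * mono S.z (S.y i) - S.H i (mono S.z (S.y i)))) (t := t)
          (C := L ^ 2 / mono S.z (S.y i) * ε ^ 2) i (by positivity) (fun s hs => by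
        have e : S.H i (S.m i s) - Λ * S.m i s + (Λ * mono S.z (S.y i) - S.H i (mono S.z (S.y i))) =
            S.m i s * (Real.log (S.m i s) - Real.log (mono S.z (S.y i))) - S.m i s + mono S.z (S.y i) := by
          rw [hΛ2]; unfold Sys.H; ring
        rw [e, abs_of_nonneg (d_nonneg (S.m_pos i s) hz)]
        refine (phi_le (S.m_pos i s) hz).trans ?_
        have h2 : |S.m i s - mono S.z (S.y i)| ≤ L * ε := (hL i s).trans (by have := h s hs; gcongr)
        have h3 : (S.m i s - mono S.z (S.y i)) ^ 2 ≤ (L * ε) ^ 2 := by rw [← sq_abs]; gcongr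
        calc _ ≤ (L * ε) ^ 2 / mono S.z (S.y i) := by gcongr
          _ = _ := by ring)
      have k5 := (le_abs_self _).trans k4
      rw [k3] at k5
      rw [k2]
      have k6 := mul_le_mul_of_nonneg_left k5 (S.hk i).le
      linarith
  have hj := Finset.sum_le_sum fun j (_ : j ∈ Finset.univ) => j1 j
  have hi := Finset.sum_le_sum fun i (_ : i ∈ Finset.univ) => i1 i
  simp only [Finset.sum_sub_distrib, Finset.sum_add_distrib, ← Finset.sum_mul] at hj hi
  have s1 : ∑ j ∈ S.W, S.G j (S.X t j) + ∑ j, (if j ∈ S.W then 0 else S.G j (S.X t j)) =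
      ∑ j, S.G j (S.X t j) := by
    have : ∑ j ∈ S.W, S.G j (S.X t j) = ∑ j, if j ∈ S.W then S.G j (S.X t j) else 0 := by
      rw [Finset.sum_ite_mem, Finset.univ_inter]
    rw [this, ← Finset.sum_add_distrib]
    exact Finset.sum_congr rfl fun j _ => by split_ifs <;> simp
  have s2 : ∑ j, S.lam j * S.vv S.z t j = ∑ j, S.lam j * (S.X t j - S.z j) +
      ∑ i, S.k i * ((∑ j, S.lam j * (S.y i j : ℝ)) * ∫ s in (t - S.τ i)..t, (S.m i s - mono S.z (S.y i))) := by
    unfold Sys.vv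
    simp only [mul_add, Finset.sum_add_distrib, Finset.mul_sum, Finset.sum_mul]
    rw [Finset.sum_comm (s := Finset.univ (α := Fin n)) (t := Finset.univ (α := Fin r))]
    congr 1
    exact Finset.sum_congr rfl fun i _ => Finset.sum_congr rfl fun j _ => by ring
  unfold ff Sys.f Sys.V Vz
  rw [s2]
  linarith

lemma fder : ∃ C : ℝ, 0 ≤ C ∧ ∀ ρ, S.Small ρ → ∀ t > S.tm, ‖S.X t - S.z‖ ≤ ρ →
    ∃ d, HasDerivAt S.ff d t ∧ -(C * ‖S.X t - S.z‖ ^ 2 * S.w t) ≤ d := by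
  have htm := S.htm
  set ca : (Fin n → ℕ) → ℝ := fun η => S.mM η * Real.exp (S.K * S.tm) / mono S.xb η with hca
  have ca0 : ∀ η, 0 ≤ ca η := fun η =>
    div_nonneg (mul_nonneg (S.mM_pos _).le (Real.exp_pos _).le) (S.xbm_pos _).le
  set Y : Fin r → ℝ := fun i => S.Zi * ∑ j, (S.y' i j : ℝ) with hY
  set B : Fin r → ℝ := fun i => S.kap i * (Y i ^ 2 * (ca (S.y i) + ca (S.y' i)) / 2) with hB
  have hB0 : ∀ i, 0 ≤ B i := fun i => by
    have := S.kap_pos i; have := ca0 (S.y i); have := ca0 (S.y' i)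
    positivity
  have hZ := S.Zi_nonneg
  refine ⟨∑ i, B i, Finset.sum_nonneg fun i _ => hB0 i, fun ρ hρ t ht hnear => ?_⟩
  refine ⟨_, S.hf S.W S.chi S.lam S.z ?_ ?_ ?_ (by linarith), ?_⟩
  · intro j hj; unfold lam; rw [if_pos hj]
  · intro i
    by_cases h : ∃ j ∈ S.W, S.y i j ≠ 0
    · rw [S.chi_one h, S.chi_one ((S.htc i).1 h)]
    · rw [S.chi_zero h, S.chi_zero (fun h' => h ((S.htc i).2 h'))]
  · intro i
    by_cases h : ∃ j ∈ S.W, S.y i j ≠ 0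
    · exact Or.inl (S.chi_one h)
    · refine Or.inr ⟨S.chi_zero h, ?_⟩
      push Not at h
      exact ⟨S.hU i h, h⟩
  · rw [Finset.sum_mul, Finset.sum_mul, ← Finset.sum_neg_distrib]
    refine Finset.sum_le_sum fun i _ => ?_
    have hw := S.w_pos t
    by_cases h : ∃ j ∈ S.W, S.y i j ≠ 0
    · rw [S.chi_one h, one_mul]
      have hc : ∀ η, (∃ j ∈ S.W, η j ≠ 0) → ∀ s ∈ Set.Icc (t - S.tm) t, S.e s η ≤ ca η * S.w t := by
        intro η hη s hs
        have h1 := S.touch_le hη ht hs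
        have := S.xbm_pos η
        unfold Sys.e
        rw [hca]
        calc _ ≤ (S.mM η * Real.exp (S.K * S.tm) * S.w t) / mono S.xb η := by gcongr
          _ = _ := by ring
      have a1 := hc _ h (t - S.τ i) ⟨by linarith [S.hτm i], by linarith [S.hτ i]⟩
      have b1 := hc _ ((S.htc i).1 h) t ⟨by linarith, le_rfl⟩
      have a0 := S.e_pos (t - S.τ i) (S.y i)
      have b0 := S.e_pos t (S.y' i)
      have hk := S.kap_pos i
      set q := ∑ j, (if j ∈ S.W then 0 else Real.log (S.X t j) - Real.log (S.xb j) - S.lam j) * (S.y' i j : ℝ) with hq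
      have q1 : |q| ≤ Y i * ‖S.X t - S.z‖ := by
        rw [hY, hq]
        refine (Finset.abs_sum_le_sum_abs _ _).trans ?_
        simp only [Finset.mul_sum, Finset.sum_mul]
        refine Finset.sum_le_sum fun j _ => ?_
        rw [abs_mul, abs_of_nonneg (Nat.cast_nonneg (α := ℝ) _)]
        have : |if j ∈ S.W then 0 else Real.log (S.X t j) - Real.log (S.xb j) - S.lam j| ≤
            S.Zi * ‖S.X t - S.z‖ := by
          unfold lam
          split_ifs with hj
          · rw [abs_zero]; positivity
          · have e : Real.log (S.X t j) - Real.log (S.xb j) - (Real.log (S.z j) - Real.log (S.xb j)) =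
              Real.log (S.X t j) - Real.log (S.z j) := by ring
            rw [e]
            refine (S.log_le hρ hnear hj).trans ?_
            have : |S.X t j - S.z j| ≤ ‖S.X t - S.z‖ := norm_le_pi_norm (S.X t - S.z) j
            gcongr
        calc _ ≤ _ := mul_le_mul_of_nonneg_right this (Nat.cast_nonneg _)
          _ = _ := by ring
      have q2 : q ^ 2 ≤ Y i ^ 2 * ‖S.X t - S.z‖ ^ 2 := by rw [← sq_abs, ← mul_pow]; gcongr
      have dq := mul_le_mul_of_nonneg_left (d_q a0 b0 q) hk.le
      refine le_trans ?_ dq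
      rw [mul_neg, neg_le_neg_iff]
      calc _ ≤ S.kap i * ((Y i ^ 2 * ‖S.X t - S.z‖ ^ 2) * (ca (S.y i) * S.w t + ca (S.y' i) * S.w t) / 2) := by gcongr
        _ = _ := by rw [hB]; ring
    · rw [S.chi_zero h, zero_mul, zero_mul]
      have := hB0 i
      have : 0 ≤ B i * ‖S.X t - S.z‖ ^ 2 * S.w t := by positivity
      linarith

lemma tendX : Tendsto (fun N => S.X (S.tN N)) atTop (nhds S.z) := by
  rw [Metric.tendsto_atTop]
  intro ε hε
  obtain ⟨N0, h⟩ := S.hlim ε hε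
  exact ⟨N0, fun N hN => by rw [dist_eq_norm]; exact h N hN _ ⟨by linarith [S.htm], le_rfl⟩⟩

lemma tendVN : Tendsto (fun N => S.V (S.tN N)) atTop (nhds S.Vz) := by
  unfold Sys.V Vz
  refine Tendsto.add (tendsto_finsetSum _ fun j _ => ?_) (tendsto_finsetSum _ fun i _ => Tendsto.const_mul _ ?_)
  · exact ((S.G_cont j).tendsto _).comp ((tendsto_pi_nhds.1 S.tendX) j)
  · rw [Metric.tendsto_atTop]
    intro ε hε
    have htm := S.htm
    have hc : Continuous fun x : Fin n → ℝ => S.H i (mono x (S.y i)) := (S.H_cont i).comp (mono_cont _)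
    obtain ⟨d, hd, h1⟩ := Metric.continuous_iff.1 hc S.z (ε / (2 * (S.tm + 1))) (by positivity)
    obtain ⟨N0, h⟩ := S.hlim d hd
    refine ⟨N0, fun N hN => ?_⟩
    have hH := ((S.H_cont i).comp (S.m_cont i)).intervalIntegrable (μ := MeasureTheory.volume) (S.tN N - S.τ i) (S.tN N)
    simp only [Function.comp_def] at hH
    have k := S.win_int' (t := S.tN N) (g := fun s => S.H i (S.m i s) - S.H i (mono S.z (S.y i)))
      (C := ε / (2 * (S.tm + 1))) i (by positivity) (fun s hs => by
        have := h1 (S.X s) (by rw [dist_eq_norm]; exact h N hN s hs)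
        rw [Real.dist_eq] at this
        exact this.le)
    rw [intervalIntegral.integral_sub hH (by simp)] at k
    simp only [intervalIntegral.integral_const, smul_eq_mul, sub_sub_cancel] at k
    rw [Real.dist_eq]
    refine k.trans_lt ?_
    have : ε / (2 * (S.tm + 1)) * S.tm = ε * (S.tm / (2 * (S.tm + 1))) := by ring
    rw [this]
    have : S.tm / (2 * (S.tm + 1)) < 1 := by rw [div_lt_one (by positivity)]; linarith
    nlinarith

lemma V_ge {t : ℝ} (ht : 0 < t) : S.Vz ≤ S.V t := by
  refine le_of_tendsto S.tendVN ?_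
  filter_upwards [S.htN.eventually_ge_atTop t] with N hN using S.V_anti ht hN

lemma tendV : Tendsto S.V atTop (nhds S.Vz) := by
  rw [Metric.tendsto_atTop]
  intro ε hε
  obtain ⟨N, h1, h2⟩ := ((Metric.tendsto_nhds.1 S.tendVN ε hε).and (S.htN.eventually_gt_atTop 0)).exists
  refine ⟨S.tN N, fun t ht => ?_⟩
  have h3 := S.V_anti h2 ht
  have h4 := S.V_ge (h2.trans_le ht)
  rw [Real.dist_eq] at h1 ⊢
  rw [abs_of_nonneg (by linarith)]
  have := (le_abs_self _).trans_lt h1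
  linarith

end
end Loc
end Dl

namespace Dl

lemma Sys.V_cont (S : Sys n r) : Continuous S.V := by
  unfold Sys.V
  refine Continuous.add (continuous_finsetSum _ fun j _ => ?_) (continuous_finsetSum _ fun i _ => continuous_const.mul ?_)
  · exact (S.G_cont j).comp ((continuous_apply j).comp S.hcont)
  · exact continuous_iff_continuousAt.2 fun t =>
      (hasDerivAt_window ((S.H_cont i).comp (S.m_cont i)) (S.τ i) t).continuousAt

namespace Loc

noncomputable section

variable (S : Loc n r)

lemma w_le {t ρ : ℝ} (h : ‖S.X t - S.z‖ ≤ ρ) : S.w t ≤ n * ρ := by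
  have hρ : 0 ≤ ρ := (norm_nonneg _).trans h
  calc S.w t ≤ ∑ j ∈ S.W, ρ := Finset.sum_le_sum fun j hj => by
        have := (norm_le_pi_norm (S.X t - S.z) j).trans h
        rw [Pi.sub_apply, S.hzW j hj, sub_zero] at this
        exact (le_abs_self _).trans this
    _ = S.W.card * ρ := by simp
    _ ≤ n * ρ := by
      have : S.W.card ≤ n := by simpa using S.W.card_le_univ
      gcongr

/-- drop of `V` over one window -/
def g (t : ℝ) : ℝ := S.V (t - S.tm) - S.V t

lemma g_nonneg {t : ℝ} (ht : S.tm < t) : 0 ≤ S.g t := by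
  have := S.V_anti (s := t - S.tm) (t := t) (by linarith) (by linarith [S.htm])
  unfold g; linarith

lemma tendg : Tendsto S.g atTop (nhds 0) := by
  have h : Tendsto (fun t => t - S.tm) atTop atTop := tendsto_atTop_add_const_right _ _ tendsto_id
  have := (S.tendV.comp h).sub S.tendV
  rw [sub_self] at this
  exact this

/-- key local estimates -/
lemma key : ∃ ρ C : ℝ, 0 < ρ ∧ 0 ≤ C ∧ ∀ t > S.tm, (∀ s ∈ Set.Icc (t - S.tm) t, ‖S.X s - S.z‖ ≤ ρ) →
    ‖S.X t - S.z‖ ≤ C * (√(S.g t) + S.g t) ∧ S.w t ≤ S.ff t ∧ S.ff t ≤ C * S.g t ∧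
    ∃ d, HasDerivAt S.ff d t ∧ -(C * S.g t * S.ff t) ≤ d := by
  obtain ⟨C1, h10, h1⟩ := S.near
  obtain ⟨C2, h20, h2⟩ := S.osc
  obtain ⟨C3, h30, h3⟩ := S.qbound
  obtain ⟨C4, h40, h4⟩ := S.fder
  set C5 := C3 * C1 ^ 2 with hC5
  have h50 : 0 ≤ C5 := by positivity
  have ev : ∀ᶠ ρ in nhdsWithin (0:ℝ) (Set.Ioi 0), ρ < 1 / (4 * C5 * n + 1) :=
    nhdsWithin_le_nhds (Iio_mem_nhds (by positivity))
  obtain ⟨ρ, hff, hsm, hρs, hρ⟩ := (S.ff_ge.and (S.ev_small.and (ev.and self_mem_nhdsWithin))).exists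
  have hρ : 0 < ρ := hρ
  have htm := S.htm
  rw [lt_div_iff₀ (by positivity)] at hρs
  set E1 := C1 * (C2 + 4 * C5 * C2 ^ 2) with hE1
  set E2 := 4 * C5 * C2 ^ 2 with hE2
  set E3 := C4 * (C1 ^ 2 * ((2 + 8 * (n * ρ) * C5) * C2 ^ 2)) with hE3
  have e1 : 0 ≤ E1 := by positivity
  have e2 : 0 ≤ E2 := by positivity
  have e3 : 0 ≤ E3 := by positivity
  refine ⟨ρ, E1 + E2 + E3, hρ, by positivity, fun t ht hnear => ?_⟩
  have ht0 := hnear t ⟨by linarith, le_rfl⟩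
  have hg := S.g_nonneg ht
  have hsq := Real.sq_sqrt hg
  have hw := S.w_pos t
  set δ := C2 * √(S.g t) with hδ
  have hδ0 : 0 ≤ δ := by positivity
  have hδ2 : δ ^ 2 = C2 ^ 2 * S.g t := by rw [hδ, mul_pow, hsq]
  have hn := h1 ρ hsm t ht ht0 δ (fun s hs => h2 t ht s hs)
  have hq := h3 t _ hn
  have hfw := hff t ht hnear
  have hV := S.V_ge (t := t) (by linarith)
  have hwn := S.w_le ht0
  have k1 : C3 * (C1 * (δ + S.w t)) ^ 2 ≤ 2 * C5 * δ ^ 2 + 2 * C5 * S.w t * S.w t := by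
    have : 0 ≤ C5 * (δ - S.w t) ^ 2 := by positivity
    rw [hC5] at this ⊢
    linarith
  have k2 : 2 * C5 * S.w t ≤ 1 / 2 := by
    have : C5 * S.w t ≤ C5 * (n * ρ) := by gcongr
    nlinarith
  have k3 : 2 * C5 * S.w t * S.w t ≤ 1 / 2 * S.w t := by gcongr
  have k4 : S.ff t ≤ 4 * C5 * δ ^ 2 := by linarith
  have hf0 : 0 < S.ff t := hw.trans_le hfw
  have k5 : S.ff t ≤ E2 * S.g t := by rw [hδ2] at k4; rw [hE2]; linarith
  have hX := hn t ⟨by linarith, le_rfl⟩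
  have hsg := Real.sqrt_nonneg (S.g t)
  refine ⟨?_, hfw, ?_, ?_⟩
  · calc _ ≤ C1 * (C2 * √(S.g t) + E2 * S.g t) := hX.trans (by gcongr; exact hfw.trans k5)
      _ ≤ C1 * ((C2 + E2) * √(S.g t) + (C2 + E2) * S.g t) := by gcongr <;> linarith
      _ = E1 * (√(S.g t) + S.g t) := by rw [hE1, hE2]; ring
      _ ≤ _ := by gcongr; linarith
  · refine k5.trans ?_
    gcongr; linarith
  · obtain ⟨d, hd, hd2⟩ := h4 ρ hsm t ht ht0
    refine ⟨d, hd, le_trans (neg_le_neg ?_) hd2⟩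
    have k6 : (δ + S.w t) ^ 2 ≤ (2 + 8 * (n * ρ) * C5) * (C2 ^ 2 * S.g t) := by
      rw [← hδ2]
      have a1 : S.w t * S.w t ≤ n * ρ * (4 * C5 * δ ^ 2) := by
        have := hfw.trans k4
        gcongr
      have a2 : 0 ≤ (δ - S.w t) ^ 2 := by positivity
      nlinarith
    calc C4 * ‖S.X t - S.z‖ ^ 2 * S.w t ≤ C4 * (C1 * (δ + S.w t)) ^ 2 * S.ff t := by gcongr
      _ = C4 * (C1 ^ 2 * (δ + S.w t) ^ 2) * S.ff t := by ring
      _ ≤ C4 * (C1 ^ 2 * ((2 + 8 * (n * ρ) * C5) * (C2 ^ 2 * S.g t))) * S.ff t := by gcongr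
      _ = E3 * S.g t * S.ff t := by rw [hE3]; ring
      _ ≤ _ := by gcongr; linarith

lemma trap {ρ C : ℝ} (hρ : 0 < ρ)
    (h : ∀ t > S.tm, (∀ s ∈ Set.Icc (t - S.tm) t, ‖S.X s - S.z‖ ≤ ρ) →
      ‖S.X t - S.z‖ ≤ C * (√(S.g t) + S.g t)) :
    ∃ T > S.tm, ∀ t ≥ T, ∀ s ∈ Set.Icc (t - S.tm) t, ‖S.X s - S.z‖ ≤ ρ := by
  have hl : Tendsto (fun t => C * (√(S.g t) + S.g t)) atTop (nhds 0) := by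
    have := ((S.tendg.sqrt).add S.tendg).const_mul C
    simpa using this
  have e1 : ∀ᶠ t in atTop, C * (√(S.g t) + S.g t) < ρ := hl.eventually_lt_const hρ
  obtain ⟨T1, hT1⟩ := eventually_atTop.1 e1
  obtain ⟨N0, hN0⟩ := S.hlim ρ hρ
  obtain ⟨N, hN, hN1, hN2⟩ := ((eventually_ge_atTop N0).and
    ((S.htN.eventually_ge_atTop T1).and (S.htN.eventually_gt_atTop S.tm))).exists
  set t0 := S.tN N with ht0
  have hw0 := hN0 N hN
  have htm := S.htm
  have hc : Continuous fun t => ‖S.X t - S.z‖ := (S.hcont.sub continuous_const).norm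
  have main : ∀ t1 ≥ t0, ‖S.X t1 - S.z‖ < ρ := by
    intro t1 ht1
    by_contra hcon
    push Not at hcon
    have hcomp : IsCompact (Set.Icc t0 t1 ∩ {t | ρ ≤ ‖S.X t - S.z‖}) :=
      isCompact_Icc.inter_right (isClosed_le continuous_const hc)
    obtain ⟨u, ⟨⟨hu1, hu2⟩, hu3⟩, hu4⟩ := hcomp.exists_isLeast ⟨t1, ⟨ht1, le_rfl⟩, hcon⟩
    have hu3 : ρ ≤ ‖S.X u - S.z‖ := hu3
    obtain ⟨v, ⟨hv1, hv2⟩, hv3⟩ := intermediate_value_Icc hu1 hc.continuousOn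
      ⟨(hw0 t0 ⟨by linarith, le_rfl⟩).le, hu3⟩
    have hvu : u ≤ v := hu4 ⟨⟨hv1, hv2.trans hu2⟩, hv3.ge⟩
    have : v = u := le_antisymm hv2 hvu
    subst this
    have hb : ∀ s ∈ Set.Icc (v - S.tm) v, ‖S.X s - S.z‖ ≤ ρ := by
      intro s hs
      rcases lt_or_ge s t0 with h1 | h1
      · exact (hw0 s ⟨by linarith [hs.1], h1.le⟩).le
      rcases hs.2.eq_or_lt with h2 | h2
      · rw [h2]; exact hv3.le
      · by_contra h3
        push Not at h3
        have := hu4 ⟨⟨h1, hs.2.trans hu2⟩, h3.le⟩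
        linarith
    have h1 := h v (by linarith) hb
    have h2 := hT1 v (by linarith)
    linarith
  refine ⟨t0, hN2, fun t ht s hs => ?_⟩
  rcases lt_or_ge s t0 with h1 | h1
  · exact (hw0 s ⟨by linarith [hs.1], h1.le⟩).le
  · exact (main s h1).le

theorem absurd_of (S : Loc n r) : False := by
  obtain ⟨ρ, C, hρ, hC0, hk⟩ := S.key
  obtain ⟨T, hT, hwin⟩ := S.trap (C := C) hρ (fun t ht h => (hk t ht h).1)
  have htm := S.htm
  have hk' : ∀ t ≥ T, S.w t ≤ S.ff t ∧ S.ff t ≤ C * S.g t ∧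
    ∃ d, HasDerivAt S.ff d t ∧ -(C * S.g t * S.ff t) ≤ d := fun t ht =>
      (hk t (by linarith) (hwin t ht)).2
  have hfpos : ∀ t ≥ T, 0 < S.ff t := fun t ht => (S.w_pos t).trans_le (hk' t ht).1
  have hd : ∀ t : ℝ, ∃ d, t > T → HasDerivAt S.ff d t ∧ -(C * S.g t * S.ff t) ≤ d := by
    intro t
    by_cases ht : t > T
    · obtain ⟨d, h⟩ := (hk' t ht.le).2.2
      exact ⟨d, fun _ => h⟩
    · exact ⟨0, fun h => absurd h ht⟩
  choose d hd using hd
  set Ψ : ℝ → ℝ := fun t => ∫ s in (t - S.tm)..t, (S.V s - S.Vz) with hΨ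
  have hΨd : ∀ t, HasDerivAt Ψ (-(S.g t)) t := fun t =>
    (hasDerivAt_window (S.V_cont.sub continuous_const) S.tm t).congr_deriv (by
      simp only [Pi.sub_apply, g]; ring)
  have hΨ0 : ∀ t > S.tm, 0 ≤ Ψ t := fun t ht =>
    intervalIntegral.integral_nonneg (by linarith) fun s hs => by
      have := S.V_ge (t := s) (by linarith [hs.1]); linarith
  set φ : ℝ → ℝ := fun t => S.ff t * Real.exp (-C * Ψ t) with hφ
  have hφd : ∀ t > T, HasDerivAt φ (d t * Real.exp (-C * Ψ t) +
      S.ff t * (Real.exp (-C * Ψ t) * (-C * -(S.g t)))) t := fun t ht =>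
    (hd t ht).1.mul (((hΨd t).const_mul (-C)).exp)
  have hinc : ∀ t ≥ T + 1, φ (T + 1) ≤ φ t := by
    intro t ht
    have := incr_le (fun t _ => hasDerivAt_const t (0:ℝ)) hφd (fun t ht _ => by
      have h1 := (hd t ht).2
      have h2 := Real.exp_pos (-C * Ψ t)
      have h3 : 0 ≤ (d t + C * S.g t * S.ff t) * Real.exp (-C * Ψ t) := mul_nonneg (by linarith) h2.le
      linarith) (show T < T + 1 by linarith) ht
    linarith
  have hpos : 0 < φ (T + 1) := mul_pos (hfpos _ (by linarith)) (Real.exp_pos _)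
  have hlow : ∀ t ≥ T + 1, φ (T + 1) ≤ C * S.g t := by
    intro t ht
    refine (hinc t ht).trans (le_trans ?_ (hk' t (by linarith)).2.1)
    have h1 : Real.exp (-C * Ψ t) ≤ 1 := Real.exp_le_one_iff.2 (by
      have := mul_nonneg hC0 (hΨ0 t (by linarith)); linarith)
    have h2 := (hfpos t (by linarith)).le
    calc _ ≤ S.ff t * 1 := mul_le_mul_of_nonneg_left h1 h2
      _ = _ := mul_one _
  have hl := S.tendg.const_mul C
  rw [mul_zero] at hl
  obtain ⟨t, h1, h2⟩ := ((hl.eventually_lt_const hpos).and (eventually_ge_atTop (T + 1))).exists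
  linarith [hlow t h2]

end
end Loc
end Dl

namespace Dl

lemma vertex {l : ℕ} {y y' : Fin r → Fin n → ℕ} {Sp : Fin l → Set (Fin n)} {grp : Fin r → Fin l}
    (hcomb : IsCombination y y' Sp grp) {W : Set (Fin n)} (hWSc : interSpecies Sp ∩ W = ∅)
    (hv : ∀ p, VertexType (stoichOn y y' (Rgrp grp p)) (W ∩ Sp p)) :
    VertexType (stoichOn y y' Finset.univ) W := by
  have dec : ∀ v ∈ stoichOn y y' Finset.univ, ∃ u : Fin l → (Fin n → ℝ),
      (∀ p, u p ∈ stoichOn y y' (Rgrp grp p)) ∧ (∀ p j, j ∉ Sp p → u p j = 0) ∧ v = ∑ p, u p := by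
    intro v hv
    refine Submodule.span_induction (p := fun v _ => ∃ u : Fin l → (Fin n → ℝ),
      (∀ p, u p ∈ stoichOn y y' (Rgrp grp p)) ∧ (∀ p j, j ∉ Sp p → u p j = 0) ∧ v = ∑ p, u p)
      ?_ ?_ ?_ ?_ hv
    · rintro v ⟨i, _, rfl⟩
      refine ⟨Pi.single (grp i) (fun j => (y' i j : ℝ) - (y i j : ℝ)), fun p => ?_, fun p j hj => ?_, ?_⟩
      · by_cases h : p = grp i
        · subst h
          rw [Pi.single_eq_same]
          exact Submodule.subset_span ⟨i, by simp [Rgrp], rfl⟩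
        · rw [Pi.single_eq_of_ne h]; exact Submodule.zero_mem _
      · by_cases h : p = grp i
        · subst h
          rw [Pi.single_eq_same]
          have := mt (hcomb.2 i j) hj
          push Not at this
          simp [this.1, this.2]
        · rw [Pi.single_eq_of_ne h]; rfl
      · rw [Finset.sum_pi_single']; simp
    · exact ⟨0, fun p => Submodule.zero_mem _, fun p j _ => rfl, by simp⟩
    · rintro a b _ _ ⟨u, h1, h2, rfl⟩ ⟨u2, h3, h4, rfl⟩
      exact ⟨u + u2, fun p => Submodule.add_mem _ (h1 p) (h3 p), fun p j hj => by
        simp [h2 p j hj, h4 p j hj], by simp [Finset.sum_add_distrib]⟩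
    · rintro c a _ ⟨u, h1, h2, rfl⟩
      exact ⟨c • u, fun p => Submodule.smul_mem _ _ (h1 p), fun p j hj => by
        simp [h2 p j hj], by simp [Finset.smul_sum]⟩
  intro v hvS hv0
  obtain ⟨u, h1, h2, rfl⟩ := dec v hvS
  refine Finset.sum_eq_zero fun p _ => hv p (u p) (h1 p) ?_
  rintro j ⟨hjW, hjp⟩
  have := hv0 j hjW
  rw [Finset.sum_apply, Finset.sum_eq_single p] at this
  · exact this
  · intro q _ hq
    refine h2 q j fun hjq => ?_
    have : j ∈ interSpecies Sp ∩ W := ⟨⟨q, p, hq, hjq, hjp⟩, hjW⟩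
    rw [hWSc] at this
    exact this
  · simp

lemma cb_sum {y y' : Fin r → Fin n → ℕ} {c : Fin r → ℝ}
    (h : ∀ η : Fin n → ℕ, ∑ i ∈ Finset.univ.filter (fun i => y i = η), c i
      = ∑ i ∈ Finset.univ.filter (fun i => y' i = η), c i) (F : (Fin n → ℕ) → ℝ) :
    ∑ i, c i * F (y i) = ∑ i, c i * F (y' i) := by
  classical
  set T := Finset.univ.image y ∪ Finset.univ.image y' with hT
  rw [← Finset.sum_fiberwise_of_maps_to (s := Finset.univ) (t := T) (g := y)
      (fun i _ => Finset.mem_union_left _ (Finset.mem_image_of_mem _ (Finset.mem_univ i))),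
    ← Finset.sum_fiberwise_of_maps_to (s := Finset.univ) (t := T) (g := y')
      (fun i _ => Finset.mem_union_right _ (Finset.mem_image_of_mem _ (Finset.mem_univ i)))]
  refine Finset.sum_congr rfl fun η _ => ?_
  have e1 : ∀ (g : Fin r → Fin n → ℕ), ∑ i ∈ Finset.univ.filter (fun i => g i = η), c i * F (g i) =
      (∑ i ∈ Finset.univ.filter (fun i => g i = η), c i) * F η := by
    intro g
    rw [Finset.sum_mul]
    exact Finset.sum_congr rfl fun i hi => by rw [(Finset.mem_filter.1 hi).2]
  rw [e1, e1]
  congr 1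
  convert h η

lemma back {y y' : Fin r → Fin n → ℕ} {k τ : Fin r → ℝ} {X : ℝ → Fin n → ℝ} {M : ℝ}
    (hk : ∀ i, 0 < k i) (hc : Continuous X) (h0 : ∀ t j, 0 ≤ X t j) (hM1 : 1 ≤ M) (hM : ∀ t j, X t j ≤ M)
    (hder : ∀ t > 0, ∀ j, HasDerivAt (fun t => X t j)
    (∑ i, k i * (mono (X (t - τ i)) (y i) * (y' i j : ℝ) - mono (X t) (y i) * (y i j : ℝ))) t) :
    ∃ K : ℝ, 0 ≤ K ∧ ∀ j s t, 0 ≤ s → s ≤ t → X s j ≤ Real.exp (K * (t - s)) * X t j := by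
  set A : Fin r → Fin n → ℝ := fun i j => k i * (y i j : ℝ) * mono (fun _ => M) (y i) with hA
  have hA0 : ∀ i j, 0 ≤ A i j := fun i j => by
    have := mono_nonneg' (x := fun _ : Fin n => M) (fun _ => by linarith) (y i)
    have := hk i
    positivity
  set K := ∑ j, ∑ i, A i j with hK
  refine ⟨K, Finset.sum_nonneg fun j _ => Finset.sum_nonneg fun i _ => hA0 i j, fun j s t hs hst => ?_⟩
  have hKj : ∑ i, A i j ≤ K := Finset.single_le_sum (f := fun j => ∑ i, A i j)
    (fun j _ => Finset.sum_nonneg fun i _ => hA0 i j) (Finset.mem_univ j)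
  have hm : MonotoneOn (fun t => Real.exp (K * t) * X t j) (Set.Ici 0) := by
    have hd : ∀ t > 0, HasDerivAt (fun t => Real.exp (K * t) * X t j) (Real.exp (K * t) * (K * 1) * X t j +
        Real.exp (K * t) * (∑ i, k i * (mono (X (t - τ i)) (y i) * (y' i j : ℝ) - mono (X t) (y i) * (y i j : ℝ)))) t :=
      fun t ht => (((hasDerivAt_id t).const_mul K).exp).mul (hder t ht j)
    have hcj : Continuous fun t => X t j := (continuous_apply j).comp hc
    refine monotoneOn_of_deriv_nonneg (convex_Ici 0) (by fun_prop) ?_ ?_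
    · rw [interior_Ici]
      exact fun t ht => (hd t ht).differentiableAt.differentiableWithinAt
    · rw [interior_Ici]
      intro t ht
      rw [(hd t ht).deriv]
      have h1 : -(∑ i, A i j) * X t j ≤
          ∑ i, k i * (mono (X (t - τ i)) (y i) * (y' i j : ℝ) - mono (X t) (y i) * (y i j : ℝ)) := by
        rw [neg_mul, Finset.sum_mul, ← Finset.sum_neg_distrib]
        refine Finset.sum_le_sum fun i _ => ?_
        have p1 := mono_nonneg' (h0 (t - τ i)) (y i)
        have p2 : 0 ≤ k i * (mono (X (t - τ i)) (y i) * (y' i j : ℝ)) := by have := hk i; positivity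
        have p3 : mono (X t) (y i) * (y i j : ℝ) ≤ mono (fun _ => M) (y i) * X t j * (y i j : ℝ) := by
          by_cases hy : y i j = 0
          · simp [hy]
          · exact mul_le_mul_of_nonneg_right (mono_le_mul hM1 (h0 t) (hM t) hy) (Nat.cast_nonneg _)
        have p4 := mul_le_mul_of_nonneg_left p3 (hk i).le
        rw [hA]
        linarith
      have h2 : (∑ i, A i j) * X t j ≤ K * X t j := mul_le_mul_of_nonneg_right hKj (h0 t j)
      have h3 := (Real.exp_pos (K * t)).le
      have h4 := mul_nonneg h3 (show 0 ≤ K * X t j + ∑ i, k i * (mono (X (t - τ i)) (y i) * (y' i j : ℝ) - mono (X t) (y i) * (y i j : ℝ)) by linarith)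
      linarith
  have h1 := hm hs (hs.trans hst) hst
  simp only at h1
  have h2 : Real.exp (K * (t - s)) * Real.exp (K * s) = Real.exp (K * t) := by
    rw [← Real.exp_add]; congr 1; ring
  rw [← h2] at h1
  have h3 := Real.exp_pos (K * s)
  refine le_of_mul_le_mul_left ?_ h3
  linarith

lemma exists_sys (y y' : Fin r → Fin n → ℕ) (k τ : Fin r → ℝ) (τm : ℝ)
    (hk : ∀ i, 0 < k i) (hτ : ∀ i, 0 ≤ τ i) (hτm : ∀ i, τ i ≤ τm) (hτm0 : 0 ≤ τm)
    (hCB : ComplexBalancedOn y y' k Finset.univ) (x : ℝ → Fin n → ℝ)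
    (hx : IsSolution y y' k τ τm x) (hp : PosInit τm x) (hb : BoundedSol τm x) :
    ∃ S : Sys n r, S.y = y ∧ S.y' = y' ∧ S.tm = τm ∧ ∀ t ≥ -τm, S.X t = x t := by
  obtain ⟨xb, hxb, hcb⟩ := hCB
  obtain ⟨hx0, hxc, hxd⟩ := hx
  obtain ⟨M, hM⟩ := hb
  set X : ℝ → Fin n → ℝ := fun t => x (max t (-τm)) with hX
  have hXx : ∀ t ≥ -τm, X t = x t := fun t ht => by rw [hX]; simp only; rw [max_eq_left ht]
  have hXc : Continuous X := hxc.comp_continuous (by fun_prop) fun t => Set.mem_Ici.2 (le_max_right _ _)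
  have hX0 : ∀ t j, 0 ≤ X t j := fun t j => hx0 _ (Set.mem_Ici.2 (le_max_right _ _)) j
  have hXM : ∀ t j, X t j ≤ max 1 M := fun t j =>
    ((le_abs_self _).trans (norm_le_pi_norm (x (max t (-τm))) j)).trans ((hM _ (Set.mem_Ici.2 (le_max_right _ _))).trans (le_max_right _ _))
  have hder : ∀ t > 0, ∀ j, HasDerivAt (fun t => X t j)
    (∑ i, k i * (mono (X (t - τ i)) (y i) * (y' i j : ℝ) - mono (X t) (y i) * (y i j : ℝ))) t := by
    intro t ht j
    have h1 := (hasDerivAt_pi.1 (hxd t ht)) j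
    have h2 : HasDerivAt (fun t => X t j) _ t := h1.congr_of_eventuallyEq (by
      filter_upwards [Ioi_mem_nhds ht] with s hs
      have hs : 0 < s := hs
      rw [hXx s (by linarith)])
    refine h2.congr_deriv (Finset.sum_congr rfl fun i _ => ?_)
    rw [hXx t (by linarith), hXx (t - τ i) (by linarith [hτm i])]
  obtain ⟨K, hK, hback⟩ := back hk hXc hX0 (le_max_left 1 M) hXM hder
  have hpos : ∀ t j, 0 < X t j := by
    intro t j
    rcases le_or_gt t 0 with h | h
    · exact hp _ ⟨le_max_right _ _, max_le h (by linarith)⟩ j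
    · have h1 := hback j 0 t le_rfl h.le
      have h2 : 0 < X 0 j := hp _ ⟨le_max_right _ _, max_le le_rfl (by linarith)⟩ j
      have h3 := h2.trans_le h1
      exact pos_of_mul_pos_right h3 (Real.exp_pos _).le
  exact ⟨{ y := y, y' := y', k := k, τ := τ, tm := τm, hk := hk, hτ := hτ, hτm := hτm, htm := hτm0,
           xb := xb, hxb := hxb, hcb := cb_sum hcb, X := X, hcont := hXc, hpos := hpos,
           M := max 1 M, hM1 := le_max_left _ _, hM := hXM, hder := hder, K := K, hK := hK, hback := hback },
    rfl, rfl, rfl, hXx⟩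

lemma Sys.V_bdd (S : Sys n r) : ∃ B, ∀ t, B ≤ S.V t := by
  refine ⟨∑ j, -(S.xb j) + ∑ i, S.k i * ((-(mono S.xb (S.y i))) * S.τ i), fun t => ?_⟩
  unfold Sys.V
  refine add_le_add (Finset.sum_le_sum fun j _ => ?_) (Finset.sum_le_sum fun i _ => ?_)
  · have := d_nonneg (S.hpos t j) (S.hxb j)
    unfold Sys.G; linarith
  · refine mul_le_mul_of_nonneg_left ?_ (S.hk i).le
    have h1 : ∫ s in (t - S.τ i)..t, (-(mono S.xb (S.y i))) = (-(mono S.xb (S.y i))) * S.τ i := by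
      rw [intervalIntegral.integral_const, smul_eq_mul]; ring
    rw [← h1]
    refine intervalIntegral.integral_mono_on (by linarith [S.hτ i]) (by simp)
      (((S.H_cont i).comp (S.m_cont i)).intervalIntegrable _ _) fun s _ => ?_
    have := d_nonneg (S.m_pos i s) (S.xbm_pos (S.y i))
    simp only [Sys.H, Function.comp]; linarith

lemma Sys.drop (S : Sys n r) : Tendsto (fun t => S.V (t - S.tm) - S.V t) atTop (nhds 0) := by
  obtain ⟨B, hB⟩ := S.V_bdd
  have ha : Antitone fun t => S.V (max 1 t) := fun s t hst =>
    S.V_anti (lt_of_lt_of_le one_pos (le_max_left _ _)) (max_le_max le_rfl hst)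
  have h1 := tendsto_atTop_ciInf ha ⟨B, by rintro _ ⟨t, rfl⟩; exact hB _⟩
  have h2 : Tendsto S.V atTop (nhds (⨅ t, S.V (max 1 t))) := h1.congr' (by
    filter_upwards [eventually_ge_atTop 1] with t ht
    rw [max_eq_right ht])
  have h : Tendsto (fun t => t - S.tm) atTop atTop := tendsto_atTop_add_const_right _ _ tendsto_id
  have := (h2.comp h).sub h2
  rw [sub_self] at this
  exact this

lemma exists_c {V : Submodule ℝ (Fin n → ℝ)} {W : Finset (Fin n)} (h : VertexType V (W : Set (Fin n))) :
    ∃ c : Fin n → Fin n → ℝ, ∀ v ∈ V, ∀ j, v j = ∑ j' ∈ W, c j j' * v j' := by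
  classical
  let P : (Fin n → ℝ) →ₗ[ℝ] (Fin n → ℝ) :=
    { toFun := fun v j => if j ∈ W then v j else 0
      map_add' := fun a b => by ext j; simp only [Pi.add_apply]; split_ifs <;> simp
      map_smul' := fun a b => by ext j; simp }
  have hinj : LinearMap.ker (P.comp V.subtype) = ⊥ := by
    rw [LinearMap.ker_eq_bot']
    rintro ⟨v, hv⟩ h0
    have : v = 0 := h v hv fun j hj => by
      have := congrFun h0 j
      simpa [P, Finset.mem_coe.1 hj] using this
    exact Subtype.ext this
  obtain ⟨g, hg⟩ := LinearMap.exists_leftInverse_of_injective _ hinj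
  refine ⟨fun j j' => (g (fun a => if j' = a then 1 else 0) : Fin n → ℝ) j, fun v hv j => ?_⟩
  have h1 : g (P v) = ⟨v, hv⟩ := LinearMap.congr_fun hg ⟨v, hv⟩
  have h2 := LinearMap.pi_apply_eq_sum_univ (V.subtype.comp g) (P v)
  have h3 : (V.subtype.comp g) (P v) = v := by simp [h1]
  rw [h3] at h2
  have h4 := congrFun h2 j
  rw [h4, Finset.sum_apply, ← Finset.sum_subset (Finset.subset_univ W)]
  · refine Finset.sum_congr rfl fun j' hj' => ?_
    simp only [P, LinearMap.coe_mk, AddHom.coe_mk, if_pos hj', Pi.smul_apply, smul_eq_mul, LinearMap.comp_apply,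
      Submodule.subtype_apply]
    ring
  · intro j' _ hj'
    simp [P, hj']

lemma no_limit (S : Sys n r) (W : Set (Fin n)) (hW : Semilocking S.y S.y' Finset.univ W)
    (hV : VertexType (stoichOn S.y S.y' Finset.univ) W) (x θ : ℝ → Fin n → ℝ)
    (hx : ∀ t ≥ -S.tm, S.X t = x t) (hθ : OmegaLimitPt S.tm x θ) (hB : OnBoundary S.tm W θ) : False := by
  classical
  obtain ⟨-, hθ0, tN, htN, hlim⟩ := hθ
  have htm := S.htm
  have h0 : (0:ℝ) ∈ Set.Icc (-S.tm) 0 := ⟨by linarith, le_rfl⟩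
  have hmem : ∀ i, (fun j => (S.y' i j : ℝ) - (S.y i j : ℝ)) ∈ stoichOn S.y S.y' Finset.univ :=
    fun i => Submodule.subset_span ⟨i, Finset.mem_univ _, rfl⟩
  have hlimX : ∀ ε > 0, ∃ N0, ∀ N ≥ N0, ‖S.X (tN N) - θ 0‖ < ε := by
    intro ε hε
    obtain ⟨N1, hN1⟩ := hlim ε hε
    obtain ⟨N2, hN2⟩ := eventually_atTop.1 (htN.eventually_ge_atTop (-S.tm))
    refine ⟨max N1 N2, fun N hN => ?_⟩
    have := hN1 N ((le_max_left _ _).trans hN) 0 h0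
    rwa [add_zero, ← hx _ (hN2 N ((le_max_right _ _).trans hN))] at this
  obtain ⟨C, hC0, hC⟩ := S.osc
  set Wf : Finset (Fin n) := (Set.toFinite W).toFinset with hWf
  have hWm : ∀ j, j ∈ Wf ↔ j ∈ W := fun j => Set.Finite.mem_toFinset _
  have hWc : (Wf : Set (Fin n)) = W := Set.Finite.coe_toFinset _
  obtain ⟨c, hc⟩ := exists_c (W := Wf) (hWc.symm ▸ hV)
  have hsl : ∀ i, (∃ j ∈ Wf, S.y' i j ≠ 0) → ∃ j ∈ Wf, S.y i j ≠ 0 := by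
    rintro i ⟨j, hj, h⟩
    obtain ⟨a, ha, hb⟩ := hW.2 i (Finset.mem_univ i) ⟨j, (hWm j).1 hj, h⟩
    exact ⟨a, (hWm a).2 ha, hb⟩
  have htc : ∀ i, (∃ j ∈ Wf, S.y i j ≠ 0) ↔ (∃ j ∈ Wf, S.y' i j ≠ 0) := by
    intro i
    refine ⟨fun h => ?_, hsl i⟩
    by_contra hn
    have hF := S.cb (fun η => if ∃ j ∈ Wf, η j ≠ 0 then 1 else 0)
    rw [← sub_eq_zero, ← Finset.sum_sub_distrib, Finset.sum_eq_zero_iff_of_nonneg] at hF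
    · have := hF i (Finset.mem_univ i)
      rw [if_pos h, if_neg hn] at this
      have := S.kap_pos i
      linarith
    · intro i _
      have := S.kap_pos i
      by_cases h' : ∃ j ∈ Wf, S.y' i j ≠ 0
      · rw [if_pos h', if_pos (hsl i h')]; simp
      · rw [if_neg h']; split_ifs <;> simp [this.le]
  refine Loc.absurd_of (n := n) (r := r)
    { toSys := S, W := Wf, z := θ 0,
      hzW := fun j hj => hB.1 0 h0 j ((hWm j).1 hj)
      hz := fun j hj => lt_of_le_of_ne (hθ0 0 h0 j) (hB.2 0 h0 j (mt (hWm j).2 hj)).symm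
      hzM := ?_
      hW := ?_
      htc := htc
      hU := ?_
      c := c
      hc := fun i j => hc _ (hmem i) j
      tN := tN
      htN := htN
      hlim := ?_ }
  · intro j
    refine le_of_forall_pos_le_add fun ε hε => ?_
    obtain ⟨N, hN⟩ := hlimX ε hε
    have h1 := (norm_le_pi_norm (S.X (tN N) - θ 0) j).trans (hN N le_rfl).le
    rw [Pi.sub_apply, Real.norm_eq_abs] at h1
    have := (abs_le.1 h1).1
    linarith [S.hM (tN N) j]
  · obtain ⟨j, hj⟩ := hW.1
    exact ⟨j, (hWm j).2 hj⟩
  · intro i hi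
    have hi' : ∀ j ∈ Wf, S.y' i j = 0 := by
      by_contra hcon
      push Not at hcon
      obtain ⟨j, hj, hne⟩ := hsl i hcon
      exact hne (hi j hj)
    have := hV _ (hmem i) (fun j hj => by simp [hi j ((hWm j).2 hj), hi' j ((hWm j).2 hj)])
    ext j
    have hj := congrFun this j
    simp only [Pi.zero_apply, sub_eq_zero] at hj
    exact_mod_cast hj.symm
  · intro ε hε
    obtain ⟨N1, hN1⟩ := hlimX (ε / 2) (by positivity)
    have hl : Tendsto (fun t => C * √(S.V (t - S.tm) - S.V t)) atTop (nhds 0) := by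
      have := (S.drop.sqrt).const_mul C
      simpa using this
    obtain ⟨N2, hN2⟩ := eventually_atTop.1 ((htN.eventually_gt_atTop S.tm).and
      (htN.eventually (hl.eventually_lt_const (show 0 < ε / 2 by positivity))))
    refine ⟨max N1 N2, fun N hN s hs => ?_⟩
    have h1 := hN1 N ((le_max_left _ _).trans hN)
    obtain ⟨h2, h3⟩ := hN2 N ((le_max_right _ _).trans hN)
    have h4 := hC _ h2 s hs
    have h5 : ‖S.X s - θ 0‖ ≤ ‖S.X s - S.X (tN N)‖ + ‖S.X (tN N) - θ 0‖ := norm_sub_le_norm_sub_add_norm_sub _ _ _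
    linarith

end Dl


theorem stmt5 {n r l : ℕ} (y y' : Fin r → Fin n → ℕ)
    (k τ : Fin r → ℝ) (τm : ℝ)
    (hk : ∀ i, 0 < k i) (hτ : ∀ i, 0 ≤ τ i) (hτm : ∀ i, τ i ≤ τm) (hτm0 : 0 ≤ τm)
    (hCB : ComplexBalancedOn y y' k Finset.univ)
    (Sp : Fin l → Set (Fin n)) (grp : Fin r → Fin l)
    (hcomb : IsCombination y y' Sp grp)
    (hsubCB : ∀ p, ComplexBalancedOn y y' k (Rgrp grp p))
    (h2d : ∀ p, Module.finrank ℝ (stoichOn y y' (Rgrp grp p)) = 2)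
    (W : Set (Fin n)) (hW : Semilocking y y' Finset.univ W)
    (hWSc : interSpecies Sp ∩ W = ∅)
    (hcaseII : ∀ p, Semilocking y y' (Rgrp grp p) (W ∩ Sp p) ∧
      VertexType (stoichOn y y' (Rgrp grp p)) (W ∩ Sp p)) :
    VertexType (stoichOn y y' Finset.univ) W ∧
    ∀ x : ℝ → Fin n → ℝ, IsSolution y y' k τ τm x → PosInit τm x → BoundedSol τm x →
      ∀ θ : ℝ → Fin n → ℝ, OmegaLimitPt τm x θ → ¬ OnBoundary τm W θ := by
  have hv := Dl.vertex hcomb hWSc fun p => (hcaseII p).2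
  refine ⟨hv, fun x hx hp hb θ hθ hB => ?_⟩
  obtain ⟨S, rfl, rfl, rfl, hX⟩ := Dl.exists_sys y y' k τ τm hk hτ hτm hτm0 hCB x hx hp hb
  exact Dl.no_limit S W hW hv x θ hX hθ hB
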